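/- arXiv:1110.4860 — 7 statements merged into one kernel-verified Lean document; each statement's English description precedes it below -/
import Mathlib

section
/- Let X be a finite set, n ≥ 1 an integer, N = {1,…,n}, and F : [0,1]^X → ℝ continuously differentiable. Define f : 2^{N×X} → ℝ by f(S) = F(x(S)), where x_j(S) = |S ∩ (N × {j})| / n for each j ∈ X. If every first partial derivative of F is antitone with respect to the coordinatewise partial order (that is, for all i ∈ X, whenever x ≤ y coordinatewise we have ∂F/∂x_i(x) ≥ ∂F/∂x_i(y)), then f is submodular: f(S ∪ T) + f(S ∩ T) ≤ f(S) + f(T) for all S, T ⊆ N × X. -/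
open Set in
/-- If the `i`-th partial derivative is antitone on the unit box, the increments of `F` in
direction `i` are antitone in the base point. -/
theorem update_increment_antitone {X : Type*} [DecidableEq X] {F : (X → ℝ) → ℝ} {i : X}
    {g : (X → ℝ) → ℝ}
    (hg : ∀ x ∈ Icc (0 : X → ℝ) 1,
      HasDerivAt (fun t => F (Function.update x i t)) (g x) (x i))
    (hanti : AntitoneOn g (Icc (0 : X → ℝ) 1))
    {x y : X → ℝ} (hx : 0 ≤ x) (hxy : x ≤ y) (hy : y ≤ 1) {d : ℝ} (hd : 0 ≤ d)
    (hyd : y i + d ≤ 1) :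
    F (Function.update y i (y i + d)) - F y ≤ F (Function.update x i (x i + d)) - F x := by
  have mem : ∀ z : X → ℝ, 0 ≤ z → z ≤ y → ∀ s ∈ Icc (0 : ℝ) d,
      Function.update z i (z i + s) ∈ Icc (0 : X → ℝ) 1 := by
    intro z hz hzy s hs
    refine ⟨le_update_iff.2 ⟨add_nonneg (hz i) hs.1, fun j _ => hz j⟩,
      update_le_iff.2 ⟨?_, fun j _ => (hzy j).trans (hy j)⟩⟩
    have := hzy i
    have := hs.2
    simp only [Pi.one_apply]
    linarith
  have der : ∀ z : X → ℝ, 0 ≤ z → z ≤ y → ∀ s ∈ Icc (0 : ℝ) d,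
      HasDerivAt (fun s => F (Function.update z i (z i + s)))
        (g (Function.update z i (z i + s))) s := by
    intro z hz hzy s hs
    have h := hg _ (mem z hz hzy s hs)
    simp only [Function.update_idem, Function.update_self] at h
    exact h.comp_const_add (z i) s
  have hy0 := hx.trans hxy
  have hder := fun s hs => (der y hy0 le_rfl s hs).sub (der x hx hxy s hs)
  have h := antitoneOn_of_hasDerivWithinAt_nonpos (convex_Icc (0 : ℝ) d)
    (fun s hs => (hder s hs).continuousAt.continuousWithinAt)
    (fun s hs => (hder s (interior_subset hs)).hasDerivWithinAt)
    (fun s hs => sub_nonpos.2 (hanti (mem x hx hxy s (interior_subset hs))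
      (mem y hy0 le_rfl s (interior_subset hs))
      (update_le_update_iff.2 ⟨by simpa using hxy i, fun j _ => hxy j⟩)))
    (left_mem_Icc.2 hd) (right_mem_Icc.2 hd) hd
  simp only [Pi.sub_apply, add_zero, Function.update_eq_self] at h
  linarith

open Set in
/-- If all partial derivatives of `F` are antitone on the unit box, the increments of `F` in any
nonnegative direction are antitone in the base point. -/
theorem increment_antitone {X : Type*} [Fintype X] [DecidableEq X] {F : (X → ℝ) → ℝ}
    {g : X → (X → ℝ) → ℝ}
    (hg : ∀ (i : X), ∀ x ∈ Icc (0 : X → ℝ) 1,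
      HasDerivAt (fun t => F (Function.update x i t)) (g i x) (x i))
    (hanti : ∀ i, AntitoneOn (g i) (Icc (0 : X → ℝ) 1))
    {x y d : X → ℝ} (hx : 0 ≤ x) (hxy : x ≤ y) (hd : 0 ≤ d) (hyd : y + d ≤ 1) :
    F (y + d) - F y ≤ F (x + d) - F x := by
  suffices h : ∀ s : Finset X, F (s.piecewise (y + d) y) - F y ≤ F (s.piecewise (x + d) x) - F x by
    simpa using h Finset.univ
  intro s
  induction s using Finset.induction_on with
  | empty => simp
  | insert i s hi ih =>
    have h := update_increment_antitone (hg i) (hanti i)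
      (x := s.piecewise (x + d) x) (y := s.piecewise (y + d) y)
      (s.le_piecewise_of_le_of_le (add_nonneg hx hd) hx)
      (s.piecewise_le_piecewise (add_le_add_left hxy d) hxy)
      (s.piecewise_le_of_le_of_le hyd ((le_add_of_nonneg_right hd).trans hyd)) (hd i)
      (by simpa [hi] using hyd i)
    simp only [Finset.piecewise_eq_of_notMem _ _ _ hi] at h
    simp only [Finset.piecewise_insert, Pi.add_apply]
    linarith

/-- If `F` is continuously differentiable on `[0,1]^X` and each first
partial derivative `g i` of `F` is antitone w.r.t. the coordinatewise order on `[0,1]^X`,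
then the discretization `f(S) = F(x(S))`, with `x_j(S) = |S ∩ (N × {j})| / n`,
is a submodular set function on `N × X` (`N = Fin n`). -/
theorem stmt_1 {X : Type*} [Fintype X] [DecidableEq X] (n : ℕ) (hn : 1 ≤ n)
    (F : (X → ℝ) → ℝ)
    (hFC1 : ContDiffOn ℝ 1 F (Set.Icc (0 : X → ℝ) 1))
    (g : X → (X → ℝ) → ℝ)
    (hg : ∀ (i : X), ∀ x ∈ Set.Icc (0 : X → ℝ) 1,
      HasDerivAt (fun t => F (Function.update x i t)) (g i x) (x i))
    (hanti : ∀ (i : X), ∀ x ∈ Set.Icc (0 : X → ℝ) 1, ∀ y ∈ Set.Icc (0 : X → ℝ) 1,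
      x ≤ y → g i y ≤ g i x)
    (f : Finset (Fin n × X) → ℝ)
    (hf : ∀ S : Finset (Fin n × X),
      f S = F (fun j => ((S.filter (fun p => p.2 = j)).card : ℝ) / n))
    (S T : Finset (Fin n × X)) :
    f (S ∪ T) + f (S ∩ T) ≤ f S + f T := by
  have hn' : (0 : ℝ) < n := by exact_mod_cast hn
  let c : Finset (Fin n × X) → X → ℝ := fun S j => ((S.filter (fun p => p.2 = j)).card : ℝ) / n
  have hmono : ∀ {A B : Finset (Fin n × X)}, A ⊆ B → c A ≤ c B := by
    intro A B hAB j
    have := Finset.card_le_card (Finset.filter_subset_filter (fun p => p.2 = j) hAB)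
    simp only [c]
    gcongr
  have hle : ∀ A : Finset (Fin n × X), c A ≤ 1 := by
    intro A j
    refine div_le_one_of_le₀ ?_ hn'.le
    have : (A.filter (fun p => p.2 = j)).card ≤ (Finset.univ : Finset (Fin n)).card := by
      refine Finset.card_le_card_of_injOn Prod.fst (fun _ _ => Finset.mem_univ _) ?_
      intro p hp q hq h
      simp only [Finset.mem_coe, Finset.mem_filter] at hp hq
      exact Prod.ext h (hp.2.trans hq.2.symm)
    simpa using this
  have hmod : c (S ∪ T) + c (S ∩ T) = c S + c T := by
    funext j
    simp only [c, Pi.add_apply, Finset.filter_union, Finset.filter_inter_distrib, ← add_div]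
    congr 1
    exact_mod_cast Finset.card_union_add_card_inter _ _
  have hU : c T + (c S - c (S ∩ T)) = c (S ∪ T) := by
    rw [← add_sub_assoc, add_comm, ← hmod, add_sub_cancel_right]
  have h := increment_antitone hg (fun i x hx y hy hxy => hanti i x hx y hy hxy)
    (x := c (S ∩ T)) (y := c T) (d := c S - c (S ∩ T))
    (fun j => by simp only [c]; positivity) (hmono Finset.inter_subset_right)
    (sub_nonneg.2 (hmono Finset.inter_subset_left)) (hU.trans_le (hle _))
  rw [hU, add_sub_cancel] at h
  have hfc : ∀ A, f A = F (c A) := hf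
  rw [hfc, hfc, hfc, hfc]
  linarith
end

section
/- Let X be a finite set, M ≥ 0, and f : 2^X → [0, M] a set function invariant under a group 𝒢 of permutations of X (f(σ(S)) = f(S) for all S ⊆ X, σ ∈ 𝒢). Let F(x) = ∑_{S⊆X} f(S) ∏_{i∈S} x_i ∏_{j∉S}(1−x_j) be its multilinear extension, x̄ = (1/|𝒢|) ∑_{σ∈𝒢} σ(x), G(x) = F(x̄), H(x) = F(x) − G(x), and D(x) = ‖x − x̄‖² = ∑_{i∈X}(x_i − x̄_i)². Then for all x ∈ [0,1]^X: (1) |∂²H/∂x_i∂x_j(x)| ≤ 8M for all i, j ∈ X; (2) ‖∇H(x)‖ ≤ 8M|X|·√(D(x)); and (3) |H(x)| ≤ 8M|X|·D(x). -/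
open scoped Classical

/-- The multilinear extension `F(x) = ∑_{S⊆X} f(S) ∏_{i∈S} x_i ∏_{j∉S} (1 - x_j)`. -/
noncomputable def mExt {X : Type*} [Fintype X] [DecidableEq X]
    (f : Set X → ℝ) (x : X → ℝ) : ℝ :=
  ∑ S : Finset X, f ↑S * ((∏ i ∈ S, x i) * ∏ j ∈ Sᶜ, (1 - x j))

/-- The symmetrization `x̄ = (1/|𝒢|) ∑_{σ∈𝒢} σ(x)`, where `(σ(x))_i = x_{σ⁻¹(i)}`. -/
noncomputable def symmetrize {X : Type*} [Fintype X] (G : Subgroup (Equiv.Perm X))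
    (x : X → ℝ) : X → ℝ :=
  fun i => (∑ σ : G, x ((σ : Equiv.Perm X)⁻¹ i)) / (Fintype.card G)

/-- `D(x) = ‖x - x̄‖² = ∑_i (x_i - x̄_i)²`. -/
noncomputable def symD {X : Type*} [Fintype X] (G : Subgroup (Equiv.Perm X))
    (x : X → ℝ) : ℝ :=
  ∑ i, (x i - symmetrize G x i) ^ 2

theorem update_mem_Icc {X : Type*} [DecidableEq X] {x : X → ℝ} (hx : x ∈ Set.Icc (0 : X → ℝ) 1) (i : X) {t : ℝ}
    (ht : t ∈ Set.Icc (0 : ℝ) 1) : Function.update x i t ∈ Set.Icc (0 : X → ℝ) 1 :=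
  ⟨le_update_iff.2 ⟨ht.1, fun j _ => hx.1 j⟩, update_le_iff.2 ⟨ht.2, fun j _ => hx.2 j⟩⟩

section MultilinearExtension

variable {X : Type*} [Fintype X] [DecidableEq X]

theorem mExt_eq_sum_prod_ite (f : Set X → ℝ) (x : X → ℝ) :
    mExt f x = ∑ S : Finset X, f ↑S * ∏ i, if i ∈ S then x i else 1 - x i := by
  unfold mExt
  refine Finset.sum_congr rfl fun S _ => ?_
  rw [Finset.prod_ite]
  congr 3 <;> ext <;> simp

theorem contDiff_mExt (f : Set X → ℝ) {n : WithTop ℕ∞} : ContDiff ℝ n (mExt f) := by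
  unfold mExt
  fun_prop

theorem differentiable_mExt (f : Set X → ℝ) : Differentiable ℝ (mExt f) :=
  (contDiff_mExt (n := 1) f).differentiable (by norm_num)

theorem mExt_update (f : Set X → ℝ) (x : X → ℝ) (i : X) (t : ℝ) :
    mExt f (Function.update x i t) = mExt f (Function.update x i 0) +
      t * (mExt f (Function.update x i 1) - mExt f (Function.update x i 0)) := by
  simp only [mExt_eq_sum_prod_ite]
  rw [← Finset.sum_sub_distrib, Finset.mul_sum, ← Finset.sum_add_distrib]
  refine Finset.sum_congr rfl fun S _ => ?_
  have key : ∀ s : ℝ, (∏ j, if j ∈ S then Function.update x i s j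
      else 1 - Function.update x i s j) =
      (if i ∈ S then s else 1 - s) *
        ∏ j ∈ Finset.univ.erase i, if j ∈ S then x j else 1 - x j := by
    intro s
    rw [← Finset.mul_prod_erase _ _ (Finset.mem_univ i), Function.update_self]
    congr 1
    refine Finset.prod_congr rfl fun j hj => ?_
    rw [Function.update_of_ne (Finset.ne_of_mem_erase hj)]
  rw [key, key, key]
  split_ifs <;> ring

theorem mExt_mem_Icc {f : Set X → ℝ} {M : ℝ} (hf : ∀ S : Set X, f S ∈ Set.Icc 0 M)
    {x : X → ℝ} (hx : x ∈ Set.Icc (0 : X → ℝ) 1) : mExt f x ∈ Set.Icc 0 M := by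
  have hw : ∀ S : Finset X, 0 ≤ (∏ i ∈ S, x i) * ∏ j ∈ Sᶜ, (1 - x j) := fun S =>
    mul_nonneg (Finset.prod_nonneg fun i _ => hx.1 i)
      (Finset.prod_nonneg fun i _ => sub_nonneg.2 (hx.2 i))
  have hsum : ∑ S : Finset X, (∏ i ∈ S, x i) * ∏ j ∈ Sᶜ, (1 - x j) = 1 := by
    rw [← Fintype.prod_add]
    simp
  refine ⟨Finset.sum_nonneg fun S _ => mul_nonneg (hf S).1 (hw S), ?_⟩
  calc mExt f x ≤ ∑ S : Finset X, M * ((∏ i ∈ S, x i) * ∏ j ∈ Sᶜ, (1 - x j)) :=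
        Finset.sum_le_sum fun S _ => mul_le_mul_of_nonneg_right (hf S).2 (hw S)
    _ = M := by rw [← Finset.mul_sum, hsum, mul_one]

theorem fderiv_single_eq_deriv_update {g : (X → ℝ) → ℝ} {x : X → ℝ}
    (hg : DifferentiableAt ℝ g x) (i : X) :
    fderiv ℝ g x (Pi.single i 1) = deriv (fun t => g (Function.update x i t)) (x i) := by
  have h := hasDerivAt_update x i (x i)
  have hg' : HasFDerivAt g (fderiv ℝ g x) (Function.update x i (x i)) := by
    rw [Function.update_eq_self]
    exact hg.hasFDerivAt
  exact (hg'.comp_hasDerivAt (x i) h).deriv.symm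

theorem fderiv_mExt_single (f : Set X → ℝ) (x : X → ℝ) (i : X) :
    fderiv ℝ (mExt f) x (Pi.single i 1) =
      mExt f (Function.update x i 1) - mExt f (Function.update x i 0) := by
  rw [fderiv_single_eq_deriv_update (differentiable_mExt f x)]
  rw [funext fun t => mExt_update f x i t]
  simp

theorem differentiable_fderiv_mExt (f : Set X → ℝ) : Differentiable ℝ (fderiv ℝ (mExt f)) :=
  ((contDiff_mExt (n := 2) f).fderiv_right (m := 1) (by norm_num)).differentiable (by norm_num)

theorem abs_fderiv_fderiv_mExt_single_le {f : Set X → ℝ} {M : ℝ}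
    (hf : ∀ S : Set X, f S ∈ Set.Icc 0 M) {x : X → ℝ} (hx : x ∈ Set.Icc (0 : X → ℝ) 1)
    (i j : X) :
    |fderiv ℝ (fderiv ℝ (mExt f)) x (Pi.single j 1) (Pi.single i 1)| ≤ 2 * M := by
  have hM : 0 ≤ M := (hf ∅).1.trans (hf ∅).2
  have hd := differentiable_fderiv_mExt f
  have h1 : fderiv ℝ (fderiv ℝ (mExt f)) x (Pi.single j 1) (Pi.single i 1) =
      fderiv ℝ (fun y => fderiv ℝ (mExt f) y (Pi.single i 1)) x (Pi.single j 1) := by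
    rw [fderiv_clm_apply (hd x) (differentiableAt_const _)]
    simp
  have hd' : Differentiable ℝ (fun y => fderiv ℝ (mExt f) y (Pi.single i 1)) :=
    hd.clm_apply (differentiable_const _)
  rw [h1, fderiv_single_eq_deriv_update (hd' x)]
  simp_rw [fderiv_mExt_single]
  rcases eq_or_ne i j with rfl | hij
  · simp [hM]
  · simp_rw [fun t s => Function.update_comm hij.symm t s x]
    rw [show (fun t => mExt f (Function.update (Function.update x i 1) j t) -
        mExt f (Function.update (Function.update x i 0) j t)) = fun t =>
        (mExt f (Function.update (Function.update x i 1) j 0) +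
          t * (mExt f (Function.update (Function.update x i 1) j 1) -
            mExt f (Function.update (Function.update x i 1) j 0))) -
        (mExt f (Function.update (Function.update x i 0) j 0) +
          t * (mExt f (Function.update (Function.update x i 0) j 1) -
            mExt f (Function.update (Function.update x i 0) j 0))) from
      funext fun t => by rw [mExt_update f _ j t, mExt_update f (Function.update x i 0) j t]]
    have hb : ∀ s ∈ Set.Icc (0 : ℝ) 1, ∀ t ∈ Set.Icc (0 : ℝ) 1,
        mExt f (Function.update (Function.update x i s) j t) ∈ Set.Icc 0 M :=
      fun s hs t ht => mExt_mem_Icc hf (update_mem_Icc (update_mem_Icc hx i hs) j ht)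
    have z : (0 : ℝ) ∈ Set.Icc (0 : ℝ) 1 := by simp
    have o : (1 : ℝ) ∈ Set.Icc (0 : ℝ) 1 := by simp
    have h00 := hb 0 z 0 z
    have h01 := hb 0 z 1 o
    have h10 := hb 1 o 0 z
    have h11 := hb 1 o 1 o
    have hder : ∀ a b c d t : ℝ, deriv (fun t : ℝ => (a + t * b) - (c + t * d)) t = b - d := by
      intro a b c d t
      have h := (((hasDerivAt_id t).mul_const b).const_add a).sub
        (((hasDerivAt_id t).mul_const d).const_add c)
      rw [one_mul, one_mul] at h
      exact h.deriv
    rw [hder, abs_le]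
    simp only [Set.mem_Icc] at h00 h01 h10 h11
    constructor <;> linarith

theorem sum_smul_single (u : X → ℝ) : u = ∑ i, u i • (Pi.single i 1 : X → ℝ) := by
  ext j
  simp [Finset.sum_apply, Pi.single_apply]

theorem abs_bilin_le {B : (X → ℝ) →L[ℝ] (X → ℝ) →L[ℝ] ℝ} {C : ℝ}
    (hB : ∀ i j, |B (Pi.single j 1) (Pi.single i 1)| ≤ C) (u v : X → ℝ) :
    |B v u| ≤ C * ((∑ i, |u i|) * ∑ j, |v j|) := by
  have h : B v u = ∑ i, ∑ j, u i * v j * B (Pi.single j 1) (Pi.single i 1) := by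
    conv_lhs => rw [sum_smul_single u, sum_smul_single v]
    simp only [map_sum, map_smul, sum_apply, smul_apply,
      smul_eq_mul, Finset.mul_sum, mul_assoc]
  rw [h, Finset.sum_mul_sum, Finset.mul_sum]
  refine (Finset.abs_sum_le_sum_abs _ _).trans (Finset.sum_le_sum fun i _ => ?_)
  rw [Finset.mul_sum]
  refine (Finset.abs_sum_le_sum_abs _ _).trans (Finset.sum_le_sum fun j _ => ?_)
  rw [abs_mul, abs_mul, mul_comm C]
  exact mul_le_mul_of_nonneg_left (hB i j) (by positivity)

theorem mExt_comp_perm {f : Set X → ℝ} {σ : Equiv.Perm X}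
    (hσ : ∀ S : Set X, f (σ '' S) = f S) (x : X → ℝ) : mExt f (x ∘ σ) = mExt f x := by
  simp only [mExt_eq_sum_prod_ite]
  refine Fintype.sum_equiv σ.finsetCongr _ _ fun S => ?_
  have hS : f ↑(σ.finsetCongr S) = f ↑S := by
    rw [← hσ ↑S]
    simp
  rw [hS]
  congr 1
  exact Fintype.prod_equiv σ _ _ fun i => by simp

end MultilinearExtension

section Symmetrization

variable {X : Type*} [Fintype X]

/-- Symmetrization as a continuous linear map. -/
noncomputable def symmetrizeCLM (G : Subgroup (Equiv.Perm X)) : (X → ℝ) →L[ℝ] (X → ℝ) :=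
  LinearMap.toContinuousLinearMap
    { toFun := symmetrize G
      map_add' := fun x y => by
        ext i
        simp [symmetrize, Finset.sum_add_distrib, add_div]
      map_smul' := fun c x => by
        ext i
        simp [symmetrize, ← Finset.mul_sum, mul_div_assoc] }

@[simp]
theorem symmetrizeCLM_apply (G : Subgroup (Equiv.Perm X)) (x : X → ℝ) :
    symmetrizeCLM G x = symmetrize G x := rfl

theorem symmetrize_eq_smul_sum (G : Subgroup (Equiv.Perm X)) (x : X → ℝ) :
    symmetrize G x = (Fintype.card G : ℝ)⁻¹ • ∑ σ : G, x ∘ ⇑((σ : Equiv.Perm X)⁻¹) := by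
  ext i
  simp [symmetrize, div_eq_inv_mul]

theorem symmetrize_comp_perm (G : Subgroup (Equiv.Perm X)) (x : X → ℝ) {τ : Equiv.Perm X}
    (hτ : τ ∈ G) : symmetrize G x ∘ τ = symmetrize G x := by
  ext i
  simp only [symmetrize, Function.comp_apply]
  congr 1
  refine Fintype.sum_equiv (Equiv.mulLeft (⟨τ, hτ⟩ : G)⁻¹) _ _ fun σ => ?_
  simp [mul_inv_rev]

theorem map_symmetrize_of_invariant (G : Subgroup (Equiv.Perm X)) {E : Type*} [AddCommGroup E]
    [Module ℝ E] (L : (X → ℝ) →ₗ[ℝ] E) {u : X → ℝ}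
    (hL : ∀ σ ∈ G, L (u ∘ ⇑σ) = L u) : L (symmetrize G u) = L u := by
  have hc : (Fintype.card G : ℝ) ≠ 0 := Nat.cast_ne_zero.2 Fintype.card_ne_zero
  rw [symmetrize_eq_smul_sum, map_smul, map_sum,
    Finset.sum_congr rfl fun σ _ => hL _ (G.inv_mem σ.2), Finset.sum_const, Finset.card_univ,
    ← Nat.cast_smul_eq_nsmul ℝ, smul_smul, inv_mul_cancel₀ hc, one_smul]

theorem symmetrize_symmetrize (G : Subgroup (Equiv.Perm X)) (x : X → ℝ) :
    symmetrize G (symmetrize G x) = symmetrize G x :=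
  map_symmetrize_of_invariant G LinearMap.id fun _ hσ => symmetrize_comp_perm G x hσ

theorem sum_abs_symmetrize_le (G : Subgroup (Equiv.Perm X)) (u : X → ℝ) :
    ∑ i, |symmetrize G u i| ≤ ∑ i, |u i| := by
  have hc : (0 : ℝ) < Fintype.card G := Nat.cast_pos.2 Fintype.card_pos
  have h : ∀ i, |symmetrize G u i| ≤
      (∑ σ : G, |u ((σ : Equiv.Perm X)⁻¹ i)|) / Fintype.card G := fun i => by
    rw [symmetrize, abs_div, abs_of_pos hc]
    gcongr
    exact Finset.abs_sum_le_sum_abs _ _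
  refine (Finset.sum_le_sum fun i _ => h i).trans ?_
  rw [← Finset.sum_div, Finset.sum_comm,
    Finset.sum_congr rfl fun (σ : G) _ => Equiv.sum_comp (σ : Equiv.Perm X)⁻¹ fun i => |u i|,
    Finset.sum_const, Finset.card_univ, nsmul_eq_mul, mul_div_cancel_left₀ _ hc.ne']

theorem symmetrize_mem_Icc (G : Subgroup (Equiv.Perm X)) {x : X → ℝ}
    (hx : x ∈ Set.Icc (0 : X → ℝ) 1) : symmetrize G x ∈ Set.Icc (0 : X → ℝ) 1 := by
  have hc : (0 : ℝ) < Fintype.card G := Nat.cast_pos.2 Fintype.card_pos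
  refine ⟨fun i => div_nonneg (Finset.sum_nonneg fun σ _ => hx.1 _) hc.le, fun i => ?_⟩
  refine (div_le_one hc).2 ((Finset.sum_le_sum (g := fun _ => (1 : ℝ)) fun σ _ => hx.2 _).trans ?_)
  simp

theorem hasDerivAt_symmetrize_add_smul (G : Subgroup (Equiv.Perm X)) (x : X → ℝ) (t : ℝ) :
    HasDerivAt (fun t : ℝ => symmetrize G x + t • (x - symmetrize G x))
      (x - symmetrize G x) t := by
  simpa using ((hasDerivAt_id t).smul_const (x - symmetrize G x)).const_add (symmetrize G x)

theorem symmetrize_add_smul_mem_Icc (G : Subgroup (Equiv.Perm X)) {x : X → ℝ}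
    (hx : x ∈ Set.Icc (0 : X → ℝ) 1) {t : ℝ}
    (ht : t ∈ Set.Icc (0 : ℝ) 1) :
    symmetrize G x + t • (x - symmetrize G x) ∈ Set.Icc (0 : X → ℝ) 1 :=
  (convex_Icc (0 : X → ℝ) 1).add_smul_sub_mem (symmetrize_mem_Icc G hx) hx ht

theorem symmetrize_symmetrize_add_smul (G : Subgroup (Equiv.Perm X)) (x : X → ℝ) (t : ℝ) :
    symmetrize G (symmetrize G x + t • (x - symmetrize G x)) = symmetrize G x := by
  rw [← symmetrizeCLM_apply, map_add, map_smul, map_sub]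
  simp [symmetrize_symmetrize]

/-- Mean value inequality along the segment from `x̄` to `x`. -/
theorem abs_sub_symmetrize_le (G : Subgroup (Equiv.Perm X)) {g : (X → ℝ) → ℝ} (hg : Differentiable ℝ g)
    {x : X → ℝ} {C : ℝ}
    (hC : ∀ t ∈ Set.Icc (0 : ℝ) 1,
      |fderiv ℝ g (symmetrize G x + t • (x - symmetrize G x)) (x - symmetrize G x)| ≤ C) :
    |g x - g (symmetrize G x)| ≤ C := by
  have h := (convex_Icc (0 : ℝ) 1).norm_image_sub_le_of_norm_hasDerivWithin_le
    (f := fun t : ℝ => g (symmetrize G x + t • (x - symmetrize G x)))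
    (fun t _ => ((hg _).hasFDerivAt.comp_hasDerivAt t
      (hasDerivAt_symmetrize_add_smul G x t)).hasDerivWithinAt) hC
    (Set.left_mem_Icc.2 zero_le_one) (Set.right_mem_Icc.2 zero_le_one)
  simpa using h

theorem sum_abs_mul_sum_abs_le (u v : X → ℝ) :
    (∑ i, |u i|) * ∑ i, |v i| ≤
      Fintype.card X * (Real.sqrt (∑ i, u i ^ 2) * Real.sqrt (∑ i, v i ^ 2)) := by
  have h : ∀ w : X → ℝ, ∑ i, |w i| ≤ Real.sqrt (Fintype.card X) * Real.sqrt (∑ i, w i ^ 2) := by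
    intro w
    rw [← Real.sqrt_mul (Nat.cast_nonneg _)]
    refine Real.le_sqrt_of_sq_le ?_
    simpa using sq_sum_le_card_mul_sum_sq (s := Finset.univ) (f := fun i => |w i|)
  calc _ ≤ (Real.sqrt (Fintype.card X) * Real.sqrt (∑ i, u i ^ 2)) *
        (Real.sqrt (Fintype.card X) * Real.sqrt (∑ i, v i ^ 2)) :=
        mul_le_mul (h u) (h v) (by positivity) (by positivity)
    _ = _ := by
        rw [mul_mul_mul_comm, Real.mul_self_sqrt (Nat.cast_nonneg _)]

end Symmetrization

section Difference

variable {X : Type*} [Fintype X] [DecidableEq X]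

/-- The difference `F(x) - F(x̄)` between the multilinear extension and its symmetrization. -/
noncomputable def symDiffExt (G : Subgroup (Equiv.Perm X)) (f : Set X → ℝ) (x : X → ℝ) : ℝ :=
  mExt f x - mExt f (symmetrize G x)

variable (G : Subgroup (Equiv.Perm X)) {f : Set X → ℝ} {M : ℝ}

theorem hasFDerivAt_symDiffExt (f : Set X → ℝ) (x : X → ℝ) :
    HasFDerivAt (symDiffExt G f)
      (fderiv ℝ (mExt f) x - (fderiv ℝ (mExt f) (symmetrize G x)).comp (symmetrizeCLM G)) x :=
  (differentiable_mExt f x).hasFDerivAt.sub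
    (HasFDerivAt.comp x (differentiable_mExt f (symmetrizeCLM G x)).hasFDerivAt
      (symmetrizeCLM G).hasFDerivAt)

theorem fderiv_symDiffExt_apply (f : Set X → ℝ) (x u : X → ℝ) :
    fderiv ℝ (symDiffExt G f) x u =
      fderiv ℝ (mExt f) x u - fderiv ℝ (mExt f) (symmetrize G x) (symmetrize G u) := by
  rw [(hasFDerivAt_symDiffExt G f x).fderiv]
  rfl

theorem hasFDerivAt_fderiv_mExt_apply (f : Set X → ℝ) (x u : X → ℝ) :
    HasFDerivAt (fun y => fderiv ℝ (mExt f) y u)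
      ((fderiv ℝ (fderiv ℝ (mExt f)) x).flip u) x := by
  have h := (differentiable_fderiv_mExt f x).hasFDerivAt.clm_apply (hasFDerivAt_const u x)
  simpa using h

theorem hasFDerivAt_fderiv_symDiffExt_apply (f : Set X → ℝ) (x u : X → ℝ) :
    HasFDerivAt (fun y => fderiv ℝ (symDiffExt G f) y u)
      ((fderiv ℝ (fderiv ℝ (mExt f)) x).flip u -
        ((fderiv ℝ (fderiv ℝ (mExt f)) (symmetrize G x)).flip (symmetrize G u)).comp
          (symmetrizeCLM G)) x := by
  rw [funext fun y => fderiv_symDiffExt_apply G f y u]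
  exact (hasFDerivAt_fderiv_mExt_apply f x u).sub
    (HasFDerivAt.comp x (hasFDerivAt_fderiv_mExt_apply f (symmetrizeCLM G x) (symmetrize G u))
      (symmetrizeCLM G).hasFDerivAt)

theorem abs_fderiv_fderiv_symDiffExt_le (hf : ∀ S : Set X, f S ∈ Set.Icc 0 M) {x : X → ℝ}
    (hx : x ∈ Set.Icc (0 : X → ℝ) 1) (u v : X → ℝ) :
    |fderiv ℝ (fun y => fderiv ℝ (symDiffExt G f) y u) x v| ≤
      4 * M * ((∑ i, |u i|) * ∑ i, |v i|) := by
  have hM : 0 ≤ M := (hf ∅).1.trans (hf ∅).2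
  rw [(hasFDerivAt_fderiv_symDiffExt_apply G f x u).fderiv]
  have h1 := abs_bilin_le (fun i j => abs_fderiv_fderiv_mExt_single_le hf hx i j) u v
  have h2 := abs_bilin_le
    (fun i j => abs_fderiv_fderiv_mExt_single_le hf (symmetrize_mem_Icc G hx) i j)
    (symmetrize G u) (symmetrize G v)
  have h3 : 2 * M * ((∑ i, |symmetrize G u i|) * ∑ i, |symmetrize G v i|) ≤
      2 * M * ((∑ i, |u i|) * ∑ i, |v i|) := by
    gcongr ?_ * (?_ * ?_)
    · exact sum_abs_symmetrize_le G u
    · exact sum_abs_symmetrize_le G v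
  change |fderiv ℝ (fderiv ℝ (mExt f)) x v u - fderiv ℝ (fderiv ℝ (mExt f)) (symmetrize G x)
    (symmetrize G v) (symmetrize G u)| ≤ _
  exact (abs_sub _ _).trans (by linarith)

theorem fderiv_symDiffExt_symmetrize
    (hinv : ∀ σ ∈ G, ∀ S : Set X, f ((σ : Equiv.Perm X) '' S) = f S) (x u : X → ℝ) :
    fderiv ℝ (symDiffExt G f) (symmetrize G x) u = 0 := by
  rw [fderiv_symDiffExt_apply, symmetrize_symmetrize, sub_eq_zero, eq_comm]
  refine map_symmetrize_of_invariant G (fderiv ℝ (mExt f) (symmetrize G x)).toLinearMap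
    fun σ hσ => ?_
  let P : (X → ℝ) →L[ℝ] (X → ℝ) :=
    ContinuousLinearMap.pi fun i => ContinuousLinearMap.proj (σ i)
  have hcomp : HasFDerivAt (fun y => mExt f (P y))
      ((fderiv ℝ (mExt f) (P (symmetrize G x))).comp P) (symmetrize G x) :=
    HasFDerivAt.comp _ (differentiable_mExt f _).hasFDerivAt P.hasFDerivAt
  have hfun : (fun y => mExt f (P y)) = mExt f := funext (mExt_comp_perm (hinv σ hσ))
  have hfix : P (symmetrize G x) = symmetrize G x := symmetrize_comp_perm G x hσ
  rw [hfun, hfix] at hcomp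
  exact (congrArg (fun L => L u) hcomp.fderiv).symm

theorem abs_fderiv_symDiffExt_le (hf : ∀ S : Set X, f S ∈ Set.Icc 0 M)
    (hinv : ∀ σ ∈ G, ∀ S : Set X, f ((σ : Equiv.Perm X) '' S) = f S) {x : X → ℝ}
    (hx : x ∈ Set.Icc (0 : X → ℝ) 1) (u : X → ℝ) :
    |fderiv ℝ (symDiffExt G f) x u| ≤
      4 * M * ((∑ i, |u i|) * ∑ i, |(x - symmetrize G x) i|) := by
  have h := abs_sub_symmetrize_le G (x := x) (g := fun y => fderiv ℝ (symDiffExt G f) y u)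
    (fun y => (hasFDerivAt_fderiv_symDiffExt_apply G f y u).differentiableAt)
    (fun t ht => abs_fderiv_fderiv_symDiffExt_le G hf (symmetrize_add_smul_mem_Icc G hx ht) u _)
  simpa only [fderiv_symDiffExt_symmetrize G hinv, sub_zero] using h

theorem abs_symDiffExt_le (hf : ∀ S : Set X, f S ∈ Set.Icc 0 M)
    (hinv : ∀ σ ∈ G, ∀ S : Set X, f ((σ : Equiv.Perm X) '' S) = f S) {x : X → ℝ}
    (hx : x ∈ Set.Icc (0 : X → ℝ) 1) :
    |symDiffExt G f x| ≤ 4 * M *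
      ((∑ i, |(x - symmetrize G x) i|) * ∑ i, |(x - symmetrize G x) i|) := by
  have hM : 0 ≤ M := (hf ∅).1.trans (hf ∅).2
  have h := abs_sub_symmetrize_le G (x := x) (g := symDiffExt G f)
    (C := 4 * M * ((∑ i, |(x - symmetrize G x) i|) * ∑ i, |(x - symmetrize G x) i|))
    (fun y => (hasFDerivAt_symDiffExt G f y).differentiableAt) fun t ht => by
      refine (abs_fderiv_symDiffExt_le G hf hinv
        (symmetrize_add_smul_mem_Icc G hx ht) _).trans ?_
      rw [symmetrize_symmetrize_add_smul, add_sub_cancel_left]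
      gcongr 4 * M * (_ * ∑ i, ?_) with i
      rw [Pi.smul_apply, smul_eq_mul, abs_mul, abs_of_nonneg ht.1]
      exact mul_le_of_le_one_left (abs_nonneg _) ht.2
  have h0 : symDiffExt G f (symmetrize G x) = 0 := by
    rw [symDiffExt, symmetrize_symmetrize, sub_self]
  rwa [h0, sub_zero] at h

end Difference

/-- for `f : 2^X → [0,M]` invariant under `𝒢`, `F` its multilinear
extension, `G(x) = F(x̄)` and `H = F - G`, one has, for all `x ∈ [0,1]^X`:
(1) `|∂²H/∂x_i∂x_j(x)| ≤ 8M`; (2) `‖∇H(x)‖ ≤ 8M|X|·√(D(x))`;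
(3) `|H(x)| ≤ 8M|X|·D(x)`. -/
theorem stmt_3 {X : Type*} [Fintype X] [DecidableEq X] (G : Subgroup (Equiv.Perm X))
    (M : ℝ) (hM : 0 ≤ M) (f : Set X → ℝ)
    (hf : ∀ S : Set X, f S ∈ Set.Icc 0 M)
    (hinv : ∀ σ ∈ G, ∀ S : Set X, f ((σ : Equiv.Perm X) '' S) = f S) :
    ∀ x ∈ Set.Icc (0 : X → ℝ) 1,
      (∀ i j : X,
        |fderiv ℝ (fun y => fderiv ℝ
            (fun z => mExt f z - mExt f (symmetrize G z)) y (Pi.single i 1))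
          x (Pi.single j 1)| ≤ 8 * M) ∧
      Real.sqrt (∑ i, (fderiv ℝ (fun z => mExt f z - mExt f (symmetrize G z))
          x (Pi.single i 1)) ^ 2)
        ≤ 8 * M * (Fintype.card X) * Real.sqrt (symD G x) ∧
      |mExt f x - mExt f (symmetrize G x)| ≤ 8 * M * (Fintype.card X) * symD G x := by
  intro x hx
  change (∀ i j : X, |fderiv ℝ (fun y => fderiv ℝ (symDiffExt G f) y (Pi.single i 1))
      x (Pi.single j 1)| ≤ 8 * M) ∧
    Real.sqrt (∑ i, (fderiv ℝ (symDiffExt G f) x (Pi.single i 1)) ^ 2)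
      ≤ 8 * M * (Fintype.card X) * Real.sqrt (symD G x) ∧
    |symDiffExt G f x| ≤ 8 * M * (Fintype.card X) * symD G x
  have hD : ∑ i, (x - symmetrize G x) i ^ 2 = symD G x := rfl
  have hD0 : 0 ≤ symD G x := Finset.sum_nonneg fun i _ => sq_nonneg _
  refine ⟨fun i j => ?_, ?_, ?_⟩
  · have hs : ∀ k : X, ∑ l, |(Pi.single k 1 : X → ℝ) l| = 1 := fun k => by
      simp [Pi.single_apply, apply_ite abs]
    have h := abs_fderiv_fderiv_symDiffExt_le G hf hx (Pi.single i 1) (Pi.single j 1)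
    rw [hs, hs] at h
    linarith
  · let g : X → ℝ := fun i => fderiv ℝ (symDiffExt G f) x (Pi.single i 1)
    change Real.sqrt (∑ i, g i ^ 2) ≤ _
    have hg : fderiv ℝ (symDiffExt G f) x g = ∑ i, g i ^ 2 := by
      conv_lhs => rw [sum_smul_single g]
      simp only [map_sum, map_smul, smul_eq_mul, sq]
      rfl
    have hbound := (le_abs_self _).trans (abs_fderiv_symDiffExt_le G hf hinv hx g)
    have hcs := sum_abs_mul_sum_abs_le g (x - symmetrize G x)
    rw [hD] at hcs
    have hsq : Real.sqrt (∑ i, g i ^ 2) * Real.sqrt (∑ i, g i ^ 2) = ∑ i, g i ^ 2 :=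
      Real.mul_self_sqrt (Finset.sum_nonneg fun i _ => sq_nonneg _)
    rw [hg, ← hsq] at hbound
    set r := Real.sqrt (∑ i, g i ^ 2)
    have hr : 0 ≤ r := Real.sqrt_nonneg _
    have hnn : 0 ≤ M * Fintype.card X * Real.sqrt (symD G x) := by positivity
    have hle : r * r ≤ r * (4 * M * Fintype.card X * Real.sqrt (symD G x)) :=
      hbound.trans ((mul_le_mul_of_nonneg_left hcs (by positivity)).trans_eq (by ring))
    rcases hr.eq_or_lt with h0 | hpos
    · rw [← h0]
      positivity
    · have := le_of_mul_le_mul_left hle hpos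
      linarith
  · have hcs := sum_abs_mul_sum_abs_le (x - symmetrize G x) (x - symmetrize G x)
    rw [hD, Real.mul_self_sqrt hD0] at hcs
    have h := (abs_symDiffExt_le G hf hinv hx).trans
      (mul_le_mul_of_nonneg_left hcs (by positivity))
    have hnn : 0 ≤ M * (Fintype.card X * symD G x) := by positivity
    linarith
end

section
/- For any real numbers α > 0 and β > 0, there exist δ ∈ (0, β) and a function φ : [0,∞) → [0,1] such that: φ is continuously differentiable on [0,∞) and twice differentiable at all but finitely many points; φ(t) = 1 for all t ∈ [0, δ]; φ(t) < e^{−1/α} for all t ≥ β; |t · φ′(t)| ≤ 4α for all t ≥ 0; and |t² · φ″(t)| ≤ 10α at every point t where φ″(t) exists. -/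
theorem Real.smoothTransition.hasCompactSupport_deriv :
    HasCompactSupport (deriv Real.smoothTransition) := by
  refine HasCompactSupport.intro (isCompact_Icc (a := (0 : ℝ)) (b := 1)) fun x hx => ?_
  rw [Set.mem_Icc, not_and_or, not_le, not_le] at hx
  rcases hx with hx | hx
  · have h : Real.smoothTransition =ᶠ[nhds x] fun _ => (0 : ℝ) := by
      filter_upwards [eventually_lt_nhds hx] with y hy
      exact Real.smoothTransition.zero_of_nonpos hy.le
    rw [h.deriv_eq, deriv_const]
  · have h : Real.smoothTransition =ᶠ[nhds x] fun _ => (1 : ℝ) := by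
      filter_upwards [eventually_gt_nhds hx] with y hy
      exact Real.smoothTransition.one_of_one_le hy.le
    rw [h.deriv_eq, deriv_const]

theorem Real.smoothTransition.contDiff_deriv : ContDiff ℝ 1 (deriv Real.smoothTransition) :=
  ContDiff.iterate_deriv' 1 1 Real.smoothTransition.contDiff

theorem Real.smoothTransition.exists_bound_deriv :
    ∃ K : ℝ, 1 ≤ K ∧ (∀ x, |deriv Real.smoothTransition x| ≤ K) ∧
      ∀ x, |deriv (deriv Real.smoothTransition) x| ≤ K := by
  obtain ⟨A, hA⟩ := hasCompactSupport_deriv.exists_bound_of_continuous contDiff_deriv.continuous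
  obtain ⟨B, hB⟩ := hasCompactSupport_deriv.deriv.exists_bound_of_continuous
    (contDiff_deriv.continuous_deriv le_rfl)
  exact ⟨max 1 (max A B), le_max_left _ _,
    fun x => (hA x).trans ((le_max_left _ _).trans (le_max_right _ _)),
    fun x => (hB x).trans ((le_max_right _ _).trans (le_max_right _ _))⟩

/-- A smooth cutoff at logarithmic scale: equal to `1` up to `β * exp (-1 / ε)`
and to `0` from `β` on. -/
noncomputable def logCutoff (ε β t : ℝ) : ℝ :=
  if t ≤ β * Real.exp (-2 / ε) then 1
  else Real.smoothTransition (ε * (Real.log β - Real.log t))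

theorem logCutoff_eventuallyEq_one {ε β t : ℝ} (hε : 0 < ε) (hβ : 0 < β)
    (ht : t ≤ β * Real.exp (-2 / ε)) : logCutoff ε β =ᶠ[nhds t] fun _ => 1 := by
  have h : t < β * Real.exp (-1 / ε) := by
    refine ht.trans_lt (mul_lt_mul_of_pos_left (Real.exp_lt_exp.2 ?_) hβ)
    exact div_lt_div_of_pos_right (by norm_num) hε
  filter_upwards [eventually_lt_nhds h] with y hy
  unfold logCutoff
  split_ifs with hyδ
  · rfl
  · have hy0 : 0 < y := lt_trans (by positivity) (not_le.1 hyδ)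
    apply Real.smoothTransition.one_of_one_le
    have hlog := Real.log_lt_log hy0 hy
    rw [Real.log_mul hβ.ne' (Real.exp_pos _).ne', Real.log_exp] at hlog
    have h1 : 1 / ε ≤ Real.log β - Real.log y := by
      rw [neg_div] at hlog
      linarith
    rw [div_le_iff₀ hε] at h1
    linarith

theorem logCutoff_eventuallyEq {ε β t : ℝ} (ht : β * Real.exp (-2 / ε) < t) :
    logCutoff ε β =ᶠ[nhds t]
      fun y => Real.smoothTransition (ε * (Real.log β - Real.log y)) := by
  filter_upwards [eventually_gt_nhds ht] with y hy
  exact if_neg hy.not_ge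

theorem hasDerivAt_log_scale (ε β : ℝ) {t : ℝ} (ht : t ≠ 0) :
    HasDerivAt (fun y => ε * (Real.log β - Real.log y)) (ε * -t⁻¹) t :=
  ((Real.hasDerivAt_log ht).const_sub _).const_mul ε

theorem contDiff_logCutoff {ε β : ℝ} (hε : 0 < ε) (hβ : 0 < β) :
    ContDiff ℝ 2 (logCutoff ε β) := by
  rw [contDiff_iff_contDiffAt]
  intro t
  rcases le_or_gt t (β * Real.exp (-2 / ε)) with ht | ht
  · exact contDiffAt_const.congr_of_eventuallyEq (logCutoff_eventuallyEq_one hε hβ ht)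
  · have ht0 : t ≠ 0 := (lt_trans (by positivity) ht).ne'
    refine ContDiffAt.congr_of_eventuallyEq ?_ (logCutoff_eventuallyEq ht)
    exact Real.smoothTransition.contDiff.contDiffAt.comp t
      (contDiffAt_const.mul (contDiffAt_const.sub (Real.contDiffAt_log.2 ht0)))

theorem deriv_logCutoff {ε β t : ℝ} (hβ : 0 < β) (ht : β * Real.exp (-2 / ε) < t) :
    deriv (logCutoff ε β) t =
      deriv Real.smoothTransition (ε * (Real.log β - Real.log t)) * (ε * -t⁻¹) := by
  have ht0 : t ≠ 0 := (lt_trans (by positivity) ht).ne'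
  rw [(logCutoff_eventuallyEq ht).deriv_eq]
  have hS := ((Real.smoothTransition.contDiff (n := 1)).differentiable one_ne_zero
    (ε * (Real.log β - Real.log t))).hasDerivAt
  exact (hS.comp t (hasDerivAt_log_scale ε β ht0)).deriv

theorem deriv_deriv_logCutoff {ε β t : ℝ} (hβ : 0 < β) (ht : β * Real.exp (-2 / ε) < t) :
    deriv (deriv (logCutoff ε β)) t =
      deriv (deriv Real.smoothTransition) (ε * (Real.log β - Real.log t)) * (ε * -t⁻¹) *
          (ε * -t⁻¹) +
        deriv Real.smoothTransition (ε * (Real.log β - Real.log t)) * (ε * (t ^ 2)⁻¹) := by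
  have ht0 : t ≠ 0 := (lt_trans (by positivity) ht).ne'
  have h : deriv (logCutoff ε β) =ᶠ[nhds t] fun y =>
      deriv Real.smoothTransition (ε * (Real.log β - Real.log y)) * (ε * -y⁻¹) := by
    filter_upwards [eventually_gt_nhds ht] with y hy
    exact deriv_logCutoff hβ hy
  rw [h.deriv_eq]
  have hS := (Real.smoothTransition.contDiff_deriv.differentiable one_ne_zero
    (ε * (Real.log β - Real.log t))).hasDerivAt
  have hinv : HasDerivAt (fun y : ℝ => ε * -y⁻¹) (ε * (t ^ 2)⁻¹) t := by
    simpa using (hasDerivAt_inv ht0).neg.const_mul ε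
  exact ((hS.comp t (hasDerivAt_log_scale ε β ht0)).mul hinv).deriv

theorem abs_mul_deriv_logCutoff_le {ε β K : ℝ} (hε : 0 < ε) (hβ : 0 < β)
    (hK : ∀ x, |deriv Real.smoothTransition x| ≤ K) (t : ℝ) :
    |t * deriv (logCutoff ε β) t| ≤ ε * K := by
  rcases le_or_gt t (β * Real.exp (-2 / ε)) with ht | ht
  · have hK0 : 0 ≤ K := (abs_nonneg _).trans (hK 0)
    rw [(logCutoff_eventuallyEq_one hε hβ ht).deriv_eq, deriv_const, mul_zero, abs_zero]
    positivity
  · have ht0 : t ≠ 0 := (lt_trans (by positivity) ht).ne'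
    rw [deriv_logCutoff hβ ht]
    set a := deriv Real.smoothTransition (ε * (Real.log β - Real.log t))
    have h : t * (a * (ε * -t⁻¹)) = -(ε * a) := by
      field_simp
    rw [h, abs_neg, abs_mul, abs_of_pos hε]
    exact mul_le_mul_of_nonneg_left (hK _) hε.le

theorem abs_sq_mul_deriv_deriv_logCutoff_le {ε β K : ℝ} (hε : 0 < ε) (hβ : 0 < β)
    (hK : ∀ x, |deriv Real.smoothTransition x| ≤ K)
    (hK' : ∀ x, |deriv (deriv Real.smoothTransition) x| ≤ K) (t : ℝ) :
    |t ^ 2 * deriv (deriv (logCutoff ε β)) t| ≤ ε ^ 2 * K + ε * K := by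
  rcases le_or_gt t (β * Real.exp (-2 / ε)) with ht | ht
  · have hK0 : 0 ≤ K := (abs_nonneg _).trans (hK 0)
    rw [(logCutoff_eventuallyEq_one hε hβ ht).deriv.deriv_eq]
    simp only [deriv_const', mul_zero, abs_zero]
    positivity
  · have ht0 : t ≠ 0 := (lt_trans (by positivity) ht).ne'
    rw [deriv_deriv_logCutoff hβ ht]
    set a := deriv Real.smoothTransition (ε * (Real.log β - Real.log t))
    set b := deriv (deriv Real.smoothTransition) (ε * (Real.log β - Real.log t))
    have h : t ^ 2 * (b * (ε * -t⁻¹) * (ε * -t⁻¹) + a * (ε * (t ^ 2)⁻¹)) =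
        ε ^ 2 * b + ε * a := by
      field_simp
    rw [h]
    refine (abs_add_le _ _).trans ?_
    rw [abs_mul, abs_mul, abs_of_pos hε, abs_of_pos (pow_pos hε 2)]
    exact add_le_add (mul_le_mul_of_nonneg_left (hK' _) (by positivity))
      (mul_le_mul_of_nonneg_left (hK _) hε.le)

/-- for any `α, β > 0` there exist `δ ∈ (0, β)` and `φ : [0,∞) → [0,1]`,
continuously differentiable on `[0,∞)` and twice differentiable outside a finite set `E`,
with `φ(t) = 1` on `[0,δ]`, `φ(t) < e^{-1/α}` for `t ≥ β`, `|t·φ'(t)| ≤ 4α` for all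
`t ≥ 0`, and `|t²·φ''(t)| ≤ 10α` wherever `φ''` exists. -/
theorem stmt_5 (α β : ℝ) (hα : 0 < α) (hβ : 0 < β) :
    ∃ (δ : ℝ) (φ : ℝ → ℝ) (E : Finset ℝ),
      0 < δ ∧ δ < β ∧
      (∀ t : ℝ, 0 ≤ t → φ t ∈ Set.Icc (0 : ℝ) 1) ∧
      ContDiffOn ℝ 1 φ (Set.Ici 0) ∧
      (∀ t : ℝ, 0 ≤ t → t ∉ E → DifferentiableAt ℝ (deriv φ) t) ∧
      (∀ t ∈ Set.Icc (0 : ℝ) δ, φ t = 1) ∧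
      (∀ t : ℝ, β ≤ t → φ t < Real.exp (-1 / α)) ∧
      (∀ t : ℝ, 0 ≤ t → |t * deriv φ t| ≤ 4 * α) ∧
      (∀ t : ℝ, 0 ≤ t → t ∉ E → |t ^ 2 * deriv (deriv φ) t| ≤ 10 * α) := by
  obtain ⟨K, hK1, hK, hK'⟩ := Real.smoothTransition.exists_bound_deriv
  have hK0 : 0 < K := one_pos.trans_le hK1
  obtain ⟨ε, hε, hε1, hεK⟩ : ∃ ε : ℝ, 0 < ε ∧ ε ≤ 1 ∧ ε * K ≤ α :=
    ⟨min 1 (α / K), by positivity, min_le_left _ _,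
      (le_div_iff₀ hK0).1 (min_le_right _ _)⟩
  have hδβ : β * Real.exp (-2 / ε) < β :=
    mul_lt_of_lt_one_right hβ (Real.exp_lt_one_iff.2 (div_neg_of_neg_of_pos (by norm_num) hε))
  have hsmooth := contDiff_logCutoff hε hβ
  refine ⟨β * Real.exp (-2 / ε), logCutoff ε β, ∅, by positivity, hδβ, fun t _ => ?_,
    (hsmooth.of_le (by norm_num)).contDiffOn, fun t _ _ => ?_, fun t ht => if_pos ht.2,
    fun t ht => ?_, fun t _ => ?_, fun t _ _ => ?_⟩
  · unfold logCutoff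
    split_ifs
    · simp
    · exact ⟨Real.smoothTransition.nonneg _, Real.smoothTransition.le_one _⟩
  · have h : ContDiff ℝ 1 (deriv (logCutoff ε β)) := ContDiff.iterate_deriv' 1 1 hsmooth
    exact h.differentiable one_ne_zero t
  · have h : logCutoff ε β t = 0 := by
      rw [logCutoff, if_neg (hδβ.trans_le ht).not_ge]
      apply Real.smoothTransition.zero_of_nonpos
      exact mul_nonpos_of_nonneg_of_nonpos hε.le (sub_nonpos.2 (Real.log_le_log hβ ht))
    rw [h]
    exact Real.exp_pos _
  · exact (abs_mul_deriv_logCutoff_le hε hβ hK t).trans (by linarith)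
  · refine (abs_sq_mul_deriv_deriv_logCutoff_le hε hβ hK hK' t).trans ?_
    have h : ε ^ 2 * K ≤ ε * K :=
      mul_le_mul_of_nonneg_right (pow_le_of_le_one hε.le hε1 two_ne_zero) hK0.le
    linarith
end

section
/- Let X be a finite set and f : 2^X → ℝ a submodular set function with multilinear extension F(x) = ∑_{S⊆X} f(S) ∏_{i∈S} x_i ∏_{j∉S}(1−x_j). Then for every x ∈ [0,1]^X, F(x) ≥ ∫₀¹ f({i ∈ X : x_i > λ}) dλ; that is, the multilinear extension is bounded below by the Lovász extension of f, equal to the expectation of f over a random threshold set T(x) = {i : x_i > λ} with λ uniform on [0,1]. -/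
/-- The multilinear extension `F(x) = ∑_{S⊆X} f(S) ∏_{i∈S} x_i ∏_{j∉S} (1 - x_j)`. -/
noncomputable def mExtF {X : Type*} [Fintype X] [DecidableEq X]
    (f : Finset X → ℝ) (x : X → ℝ) : ℝ :=
  ∑ S : Finset X, f S * ((∏ i ∈ S, x i) * ∏ j ∈ Sᶜ, (1 - x j))

/-- The multilinear extension of `S ↦ 1` is `1`. -/
theorem sum_prod_mul_prod_compl_one_sub {X : Type*} [Fintype X] [DecidableEq X] (x : X → ℝ) :
    ∑ S : Finset X, (∏ i ∈ S, x i) * ∏ j ∈ Sᶜ, (1 - x j) = 1 := by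
  simpa [Finset.compl_eq_univ_sdiff] using
    (Finset.prod_add x (fun j => 1 - x j) Finset.univ).symm

/-- The multilinear extension of the indicator of `i ∈ S` is `x i`. -/
theorem sum_ite_mem_prod_mul_prod_compl_one_sub {X : Type*} [Fintype X] [DecidableEq X]
    (x : X → ℝ) (i : X) :
    ∑ S : Finset X, (if i ∈ S then (∏ k ∈ S, x k) * ∏ j ∈ Sᶜ, (1 - x j) else 0) = x i := by
  have h := Finset.prod_add x (fun j => if j = i then 0 else 1 - x j) Finset.univ
  rw [Finset.prod_eq_single i (fun j _ hj => by simp [hj]) (by simp)] at h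
  simp only [if_true, add_zero, Finset.powerset_univ] at h
  rw [h]
  refine Finset.sum_congr rfl fun S _ => ?_
  rw [← Finset.compl_eq_univ_sdiff]
  split_ifs with hi
  · congr 1
    refine Finset.prod_congr rfl fun j hj => ?_
    rw [if_neg]
    rintro rfl
    exact Finset.mem_compl.1 hj hi
  · rw [Finset.prod_eq_zero (Finset.mem_compl.2 hi) (by simp), mul_zero]

/-- The multilinear extension of an affine (modular) set function is affine. -/
theorem mExtF_const_add_sum {X : Type*} [Fintype X] [DecidableEq X] (c : ℝ) (m x : X → ℝ) :
    mExtF (fun S => c + ∑ i ∈ S, m i) x = c + ∑ i, m i * x i := by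
  unfold mExtF
  simp only [add_mul, Finset.sum_add_distrib]
  rw [← Finset.mul_sum, sum_prod_mul_prod_compl_one_sub, mul_one]
  congr 1
  simp only [Finset.sum_mul]
  have hx : ∀ i, m i * x i = ∑ S : Finset X,
      if i ∈ S then m i * ((∏ k ∈ S, x k) * ∏ j ∈ Sᶜ, (1 - x j)) else 0 := fun i => by
    conv_lhs => rw [← sum_ite_mem_prod_mul_prod_compl_one_sub x i, Finset.mul_sum]
    simp only [mul_ite, mul_zero]
  rw [Finset.sum_congr rfl fun i _ => hx i, Finset.sum_comm]
  refine Finset.sum_congr rfl fun S _ => ?_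
  rw [Finset.sum_ite_mem, Finset.univ_inter]

/-- On the unit cube the multilinear extension is monotone in the set function. -/
theorem mExtF_mono {X : Type*} [Fintype X] [DecidableEq X] {f g : Finset X → ℝ} (h : f ≤ g)
    {x : X → ℝ} (hx : x ∈ Set.Icc (0 : X → ℝ) 1) : mExtF f x ≤ mExtF g x :=
  Finset.sum_le_sum fun S _ => mul_le_mul_of_nonneg_right (h S) <|
    mul_nonneg (Finset.prod_nonneg fun i _ => hx.1 i)
      (Finset.prod_nonneg fun i _ => sub_nonneg.2 (hx.2 i))

/-- Greedy algorithm: a submodular function has a modular minorant on the subsets of `A` that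
agrees with it on all superlevel sets of a given `x`. -/
theorem exists_modular_minorant {X : Type*} [DecidableEq X] (f : Finset X → ℝ)
    (hsub : ∀ S T : Finset X, f (S ∪ T) + f (S ∩ T) ≤ f S + f T) (x : X → ℝ) (A : Finset X) :
    ∃ m : X → ℝ, (∀ S ⊆ A, f ∅ + ∑ i ∈ S, m i ≤ f S) ∧ f ∅ + ∑ i ∈ A, m i = f A ∧
      ∀ t : ℝ, f ∅ + ∑ i ∈ A with t < x i, m i = f (A.filter fun i => t < x i) := by
  induction A using Finset.induction_on_max_value (fun i => -x i) with
  | empty => exact ⟨0, by simp [Finset.subset_empty]⟩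
  | insert a A ha hmin ih =>
    obtain ⟨m, hle, htop, hlevel⟩ := ih
    have hcongr : ∀ S : Finset X, a ∉ S →
        ∑ i ∈ S, Function.update m a (f (insert a A) - f A) i = ∑ i ∈ S, m i :=
      fun S hS => Finset.sum_update_of_notMem hS _ _
    have htop' : f ∅ + ∑ i ∈ insert a A, Function.update m a (f (insert a A) - f A) i =
        f (insert a A) := by
      rw [Finset.sum_insert ha, hcongr A ha, Function.update_self]
      linarith
    refine ⟨Function.update m a (f (insert a A) - f A), fun S hS => ?_, htop', fun t => ?_⟩
    · by_cases haS : a ∈ S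
      · have hS' : S.erase a ⊆ A := Finset.subset_insert_iff.1 hS
        have hunion : S ∪ A = insert a A := by grind
        have hinter : S ∩ A = S.erase a := by grind
        have h := hsub S A
        rw [hunion, hinter] at h
        rw [← Finset.add_sum_erase S _ haS, hcongr _ (Finset.notMem_erase a S),
          Function.update_self]
        linarith [hle _ hS']
      · rw [hcongr S haS]
        exact hle S ((Finset.subset_insert_iff_of_notMem haS).1 hS)
    · by_cases hat : t < x a
      · rw [Finset.filter_true_of_mem fun i hi => ?_]
        · exact htop'
        · rcases Finset.mem_insert.1 hi with rfl | hi
          · exact hat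
          · exact hat.trans_le (neg_le_neg_iff.1 (hmin i hi))
      · rw [Finset.filter_insert, if_neg hat, hcongr _ fun h => ha (Finset.mem_filter.1 h).1]
        exact hlevel t

/-- The Lovász extension of an affine (modular) set function is affine. -/
theorem integral_const_add_sum_superlevel {X : Type*} [Fintype X] (c : ℝ) (m : X → ℝ)
    {x : X → ℝ} (hx : x ∈ Set.Icc (0 : X → ℝ) 1) :
    ∫ t in (0 : ℝ)..1, (c + ∑ i with t < x i, m i) = c + ∑ i, m i * x i := by
  have hind : ∀ i, (fun t : ℝ => if t < x i then m i else 0) =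
      (Set.Iio (x i)).indicator fun _ => m i := fun i => by
    ext t
    simp [Set.indicator_apply]
  have hint : ∀ i, IntervalIntegrable (fun t : ℝ => if t < x i then m i else 0)
      MeasureTheory.volume 0 1 := fun i => by
    rw [hind, intervalIntegrable_iff]
    exact (intervalIntegrable_iff.1 intervalIntegrable_const).indicator measurableSet_Iio
  have hsum : IntervalIntegrable (fun t : ℝ => ∑ i, if t < x i then m i else 0)
      MeasureTheory.volume 0 1 := by
    simpa only [Finset.sum_fn] using IntervalIntegrable.sum Finset.univ fun i _ => hint i
  simp only [Finset.sum_filter]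
  rw [intervalIntegral.integral_add intervalIntegrable_const hsum,
    intervalIntegral.integral_finsetSum fun i _ => hint i]
  congr 1
  · simp
  refine Finset.sum_congr rfl fun i _ => ?_
  have h0 : 0 ≤ x i := hx.1 i
  have h1 : x i ≤ 1 := hx.2 i
  rw [hind, intervalIntegral.integral_of_le zero_le_one,
    MeasureTheory.setIntegral_indicator measurableSet_Iio]
  have hset : Set.Ioc 0 1 ∩ Set.Iio (x i) = Set.Ioo 0 (x i) := by
    ext t
    simp only [Set.mem_inter_iff, Set.mem_Ioc, Set.mem_Iio, Set.mem_Ioo]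
    constructor
    · exact fun h => ⟨h.1.1, h.2⟩
    · exact fun h => ⟨⟨h.1, h.2.le.trans h1⟩, h.2⟩
  rw [hset]
  simp [h0, mul_comm]

/-- for a submodular `f`, the multilinear extension dominates the
Lovász extension: `F(x) ≥ ∫₀¹ f({i : x_i > λ}) dλ` for every `x ∈ [0,1]^X`. -/
theorem stmt_7 {X : Type*} [Fintype X] [DecidableEq X] (f : Finset X → ℝ)
    (hsub : ∀ S T : Finset X, f (S ∪ T) + f (S ∩ T) ≤ f S + f T)
    (x : X → ℝ) (hx : x ∈ Set.Icc (0 : X → ℝ) 1) :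
    (∫ lam in (0 : ℝ)..1, f (Finset.univ.filter fun i => lam < x i)) ≤ mExtF f x := by
  obtain ⟨m, hle, -, hlevel⟩ := exists_modular_minorant f hsub x Finset.univ
  simp only [← hlevel]
  rw [integral_const_add_sum_superlevel _ _ hx, ← mExtF_const_add_sum]
  exact mExtF_mono (fun S => hle S (Finset.subset_univ S)) hx
end

section
/- Let X be a finite set, f : 2^X → ℝ a submodular set function with multilinear extension F, and X = X₁ ∪ X₂ a partition of X into two disjoint parts. Then for every x ∈ [0,1]^X, F(x) ≥ ∫₀¹ ∫₀¹ f( {i ∈ X₁ : x_i > λ₁} ∪ {i ∈ X₂ : x_i > λ₂} ) dλ₁ dλ₂; that is, F(x) is at least the expected value of f on the union of two independent random threshold sets, one applied to the coordinates in X₁ and one to the coordinates in X₂. -/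
open Finset

/-- The expectation of `g` over the random subset of `Y` containing each `i ∈ Y` independently
with probability `x i`. -/
noncomputable def productExpectation {X : Type*} [DecidableEq X] (x : X → ℝ) (Y : Finset X)
    (g : Finset X → ℝ) : ℝ :=
  ∑ S ∈ Y.powerset, g S * ((∏ i ∈ S, x i) * ∏ j ∈ Y \ S, (1 - x j))

section productExpectation

variable {X : Type*} [DecidableEq X] {x : X → ℝ}

theorem productExpectation_empty (g : Finset X → ℝ) : productExpectation x ∅ g = g ∅ := by
  simp [productExpectation]

theorem productExpectation_add (Y : Finset X) (g h : Finset X → ℝ) :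
    productExpectation x Y (fun S => g S + h S)
      = productExpectation x Y g + productExpectation x Y h := by
  simp only [productExpectation, add_mul, sum_add_distrib]

theorem productExpectation_const_mul (Y : Finset X) (c : ℝ) (g : Finset X → ℝ) :
    productExpectation x Y (fun S => c * g S) = c * productExpectation x Y g := by
  simp only [productExpectation, mul_sum, mul_assoc]

theorem productExpectation_const (Y : Finset X) (c : ℝ) :
    productExpectation x Y (fun _ => c) = c := by
  have h := prod_add x (fun i => 1 - x i) Y
  simp only [add_sub_cancel, prod_const_one] at h
  rw [productExpectation, ← mul_sum, ← h, mul_one]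

theorem productExpectation_mono (hx : x ∈ Set.Icc (0 : X → ℝ) 1) {Y : Finset X}
    {g h : Finset X → ℝ} (hgh : ∀ S ⊆ Y, g S ≤ h S) :
    productExpectation x Y g ≤ productExpectation x Y h :=
  sum_le_sum fun S hS => mul_le_mul_of_nonneg_right (hgh S (mem_powerset.1 hS)) <|
    mul_nonneg (prod_nonneg fun i _ => hx.1 i)
      (prod_nonneg fun i _ => sub_nonneg.2 (hx.2 i))

theorem productExpectation_insert {a : X} {Y : Finset X} (ha : a ∉ Y) (g : Finset X → ℝ) :
    productExpectation x (insert a Y) g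
      = productExpectation x Y (fun S => (1 - x a) * g S + x a * g (insert a S)) := by
  rw [productExpectation, sum_powerset_insert ha, productExpectation, ← sum_add_distrib]
  refine sum_congr rfl fun S hS => ?_
  have haS : a ∉ S := fun h => ha (mem_powerset.1 hS h)
  rw [insert_sdiff_of_notMem _ haS, insert_sdiff_insert, sdiff_insert_of_notMem ha,
    prod_insert haS, prod_insert (fun h => ha (mem_sdiff.1 h).1)]
  ring

theorem productExpectation_union {Y Z : Finset X} (hYZ : Disjoint Y Z) (g : Finset X → ℝ) :
    productExpectation x (Y ∪ Z) g
      = productExpectation x Y (fun S => productExpectation x Z (fun T => g (S ∪ T))) := by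
  induction Y using Finset.induction_on generalizing g with
  | empty => simp [productExpectation_empty]
  | insert a Y ha ih =>
    rw [disjoint_insert_left] at hYZ
    rw [insert_union, productExpectation_insert (by simp [ha, hYZ.1]), ih hYZ.2,
      productExpectation_insert ha]
    simp only [productExpectation_add, productExpectation_const_mul, insert_union]

theorem mExtF_eq_productExpectation [Fintype X] (f : Finset X → ℝ) :
    mExtF f x = productExpectation x univ f := by
  simp [mExtF, productExpectation, compl_eq_univ_sdiff]

end productExpectation

section thresholdSet

variable {X : Type*} [DecidableEq X] {x : X → ℝ}

theorem apply_threshold_insert {a : X} {Y : Finset X} (hmin : ∀ i ∈ Y, x a ≤ x i)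
    (g : Finset X → ℝ) (t : ℝ) :
    g ((insert a Y).filter fun i => t < x i)
      = g (Y.filter fun i => t < x i)
        + (Set.Iio (x a)).indicator (fun _ => g (insert a Y) - g Y) t := by
  by_cases ht : t < x a
  · have hY : (Y.filter fun i => t < x i) = Y :=
      filter_true_of_mem fun i hi => ht.trans_le (hmin i hi)
    simp [filter_insert, ht, hY]
  · simp [filter_insert, ht]

theorem intervalIntegrable_indicator_Iio_const (a b c y : ℝ) :
    IntervalIntegrable ((Set.Iio y).indicator fun _ => c) MeasureTheory.volume a b := by
  have h : IntervalIntegrable (fun _ : ℝ => c) MeasureTheory.volume a b := by simp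
  exact ⟨h.1.indicator measurableSet_Iio, h.2.indicator measurableSet_Iio⟩

theorem intervalIntegrable_threshold (Y : Finset X) (g : Finset X → ℝ) (a b : ℝ) :
    IntervalIntegrable (fun t => g (Y.filter fun i => t < x i)) MeasureTheory.volume a b := by
  induction Y using Finset.induction_on_min_value x with
  | empty => simp
  | insert c Y hc hmin ih =>
    simp only [apply_threshold_insert hmin g]
    exact ih.add (intervalIntegrable_indicator_Iio_const _ _ _ _)

theorem integral_indicator_Iio_const {y : ℝ} (hy0 : 0 ≤ y) (hy1 : y ≤ 1) (c : ℝ) :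
    ∫ t in (0 : ℝ)..1, (Set.Iio y).indicator (fun _ => c) t = y * c := by
  have h : ∫ t in (0 : ℝ)..1, (Set.Iio y).indicator (fun _ => c) t
      = ∫ t in (0 : ℝ)..1, (Set.Iic y).indicator (fun _ => c) t := by
    refine intervalIntegral.integral_congr_ae ?_
    filter_upwards [MeasureTheory.Measure.ae_ne MeasureTheory.volume y] with t ht _
    simp [Set.indicator, lt_iff_le_and_ne, ht]
  rw [h]
  have := intervalIntegral.integral_indicator (μ := MeasureTheory.volume) (f := fun _ => c)
    (Set.mem_Icc.2 ⟨hy0, hy1⟩)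
  simpa [Set.Iic] using this

/-- A submodular function has smaller expectation on the random threshold set of `x` than on the
independent random set with the same marginals. -/
theorem integral_threshold_le_productExpectation (hx : x ∈ Set.Icc (0 : X → ℝ) 1)
    {g : Finset X → ℝ} (hg : ∀ S T : Finset X, g (S ∪ T) + g (S ∩ T) ≤ g S + g T)
    (Y : Finset X) :
    ∫ t in (0 : ℝ)..1, g (Y.filter fun i => t < x i) ≤ productExpectation x Y g := by
  induction Y using Finset.induction_on_min_value x with
  | empty => simp [productExpectation_empty]
  | insert a Y ha hmin ih =>
    simp only [apply_threshold_insert hmin g]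
    rw [intervalIntegral.integral_add (intervalIntegrable_threshold Y g 0 1)
        (intervalIntegrable_indicator_Iio_const _ _ _ _),
      integral_indicator_Iio_const (hx.1 a) (hx.2 a), productExpectation_insert ha]
    refine (add_le_add_left ih _).trans ?_
    rw [← productExpectation_const (x := x) Y (x a * (g (insert a Y) - g Y)),
      ← productExpectation_add]
    refine productExpectation_mono hx fun S hS => ?_
    have h := hg (insert a S) Y
    rw [insert_union, union_eq_right.2 hS, insert_inter_of_notMem ha,
      inter_eq_left.2 hS] at h
    nlinarith [mul_le_mul_of_nonneg_left h (hx.1 a)]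

end thresholdSet

/-- for a submodular `f` and a partition `X = X₁ ∪ X₂`, the multilinear
extension dominates the expectation of `f` over the union of two independent random
threshold sets, one on `X₁` and one on `X₂`:
`F(x) ≥ ∫₀¹∫₀¹ f({i ∈ X₁ : x_i > λ₁} ∪ {i ∈ X₂ : x_i > λ₂}) dλ₁ dλ₂`. -/
theorem stmt_8 {X : Type*} [Fintype X] [DecidableEq X] (f : Finset X → ℝ)
    (hsub : ∀ S T : Finset X, f (S ∪ T) + f (S ∩ T) ≤ f S + f T)
    (X₁ X₂ : Finset X) (hcover : X₁ ∪ X₂ = Finset.univ) (hdisj : Disjoint X₁ X₂)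
    (x : X → ℝ) (hx : x ∈ Set.Icc (0 : X → ℝ) 1) :
    (∫ lam₁ in (0 : ℝ)..1, ∫ lam₂ in (0 : ℝ)..1,
        f ((X₁.filter fun i => lam₁ < x i) ∪ (X₂.filter fun i => lam₂ < x i)))
      ≤ mExtF f x := by
  have hf : ∀ T S S' : Finset X, f (S ∪ S' ∪ T) + f (S ∩ S' ∪ T) ≤ f (S ∪ T) + f (S' ∪ T) := by
    intro T S S'
    have h := hsub (S ∪ T) (S' ∪ T)
    rwa [← union_union_distrib_right, ← inter_union_distrib_right] at h
  rw [mExtF_eq_productExpectation, ← hcover, productExpectation_union hdisj]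
  refine le_trans ?_ (integral_threshold_le_productExpectation hx
    (g := fun S => productExpectation x X₂ fun T => f (S ∪ T)) ?_ X₁)
  · refine intervalIntegral.integral_mono_on zero_le_one
      (intervalIntegrable_threshold X₁ (fun S => ∫ t in (0 : ℝ)..1,
        f (S ∪ X₂.filter fun i => t < x i)) 0 1)
      (intervalIntegrable_threshold X₁
        (fun S => productExpectation x X₂ fun T => f (S ∪ T)) 0 1) fun s _ => ?_
    refine integral_threshold_le_productExpectation hx
      (g := fun T => f ((X₁.filter fun i => s < x i) ∪ T)) (fun S S' => ?_) X₂
    simpa only [union_comm] using hf (X₁.filter fun i => s < x i) S S'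
  · intro S S'
    simp only [← productExpectation_add]
    exact productExpectation_mono hx fun T _ => hf T S S'
end

section
/- Let M be a matroid on a finite ground set X and let I and C be independent sets of M. Then there is an assignment π sending each element j ∈ C ∖ I to a subset π(j) ⊆ I ∖ C with |π(j)| ≤ 1, such that (I ∖ π(j)) ∪ {j} is independent in M for every j ∈ C ∖ I, and the sets π(j) for distinct j ∈ C ∖ I are pairwise disjoint (each element i ∈ I ∖ C appears as π(j) = {i} for at most one j). -/
open Set in
/-- If `I` and `C` are independent and `A ⊆ C \ I` is spanned by `I`, then the fundamental circuits
of the elements of `A` together meet `I \ C` in at least as many elements as `A` has. -/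
theorem Matroid.Indep.encard_le_encard_biUnion_fundCircuit {α : Type*} {M : Matroid α}
    [M.Finite] {I C A : Set α} (hI : M.Indep I) (hC : M.Indep C) (hAC : A ⊆ C \ I)
    (hAI : A ⊆ M.closure I) :
    A.encard ≤ (⋃ j ∈ A, M.fundCircuit j I ∩ (I \ C)).encard := by
  set N := ⋃ j ∈ A, M.fundCircuit j I ∩ (I \ C)
  have hNI : N ⊆ I := iUnion₂_subset fun j _ ↦ inter_subset_right.trans sdiff_subset
  have hground : I ∩ C ∪ N ⊆ M.E :=
    (union_subset inter_subset_left hNI).trans hI.subset_ground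
  have hsub : I ∩ C ∪ A ⊆ M.closure (I ∩ C ∪ N) := by
    refine union_subset (subset_union_left.trans (M.subset_closure _ hground)) fun j hj ↦ ?_
    have hjI : j ∉ I := (hAC hj).2
    have hmem := (hI.fundCircuit_isCircuit (hAI hj) hjI).mem_closure_sdiff_singleton_of_mem
      (M.mem_fundCircuit j I)
    refine M.closure_subset_closure ?_ hmem
    rw [M.fundCircuit_sdiff_eq_inter hjI]
    rintro x ⟨hx, hxI⟩
    by_cases hxC : x ∈ C
    · exact .inl ⟨hxI, hxC⟩
    · exact .inr (mem_biUnion hj ⟨hx, hxI, hxC⟩)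
  have hindep : M.Indep (I ∩ C ∪ A) :=
    hC.subset (union_subset inter_subset_right (hAC.trans sdiff_subset))
  have hdisj : Disjoint (I ∩ C) A :=
    disjoint_left.2 fun x hx hxA ↦ (hAC hxA).2 hx.1
  have hle : (I ∩ C).encard + A.encard ≤ (I ∩ C).encard + N.encard := by
    rw [← encard_union_eq hdisj]
    calc (I ∩ C ∪ A).encard ≤ M.eRk (M.closure (I ∩ C ∪ N)) := hindep.encard_le_eRk_of_subset hsub
      _ = M.eRk (I ∩ C ∪ N) := M.eRk_closure_eq _
      _ ≤ (I ∩ C ∪ N).encard := M.eRk_le_encard _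
      _ ≤ _ := encard_union_le _ _
  exact (ENat.add_le_add_iff_left (hI.finite.subset inter_subset_left).encard_lt_top.ne).1 hle

/-- for independent sets `I, C` of a matroid on a finite ground set,
there is a map `π` sending each `j ∈ C \ I` to a subset `π(j) ⊆ I \ C` of size at most
one, with `(I \ π(j)) ∪ {j}` independent for each `j ∈ C \ I`, and the sets `π(j)`
pairwise disjoint. -/
theorem stmt_9 {α : Type*} (M : Matroid α) [M.Finite] {I C : Set α}
    (hI : M.Indep I) (hC : M.Indep C) :
    ∃ π : α → Set α,
      (∀ j ∈ C \ I, π j ⊆ I \ C ∧ (π j).encard ≤ 1 ∧ M.Indep (insert j (I \ π j))) ∧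
      (∀ j ∈ C \ I, ∀ j' ∈ C \ I, j ≠ j' → Disjoint (π j) (π j')) := by
  classical
  have hfin (j : α) : (M.fundCircuit j I ∩ (I \ C)).Finite :=
    hI.finite.subset (Set.inter_subset_right.trans Set.sdiff_subset)
  obtain ⟨f, hf_inj, hf⟩ := (Finset.all_card_le_biUnion_card_iff_exists_injective
    fun j : {j // j ∈ C \ I ∧ j ∈ M.closure I} ↦ (hfin j).toFinset).1 fun s ↦ by
      have h := hI.encard_le_encard_biUnion_fundCircuit hC
        (A := Subtype.val '' (s : Set {j // j ∈ C \ I ∧ j ∈ M.closure I}))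
        (by rintro _ ⟨j, -, rfl⟩; exact j.2.1) (by rintro _ ⟨j, -, rfl⟩; exact j.2.2)
      rw [Subtype.val_injective.encard_image, Set.encard_coe_eq_coe_finsetCard,
        Set.biUnion_image] at h
      rw [← ENat.natCast_le_natCast, ← Set.encard_coe_eq_coe_finsetCard (s.biUnion _)]
      simpa using h
  simp only [Set.Finite.mem_toFinset] at hf
  refine ⟨fun j ↦ {i | ∃ h : j ∈ C \ I ∧ j ∈ M.closure I, f ⟨j, h⟩ = i}, fun j hj ↦ ?_,
    fun j _ j' _ hne ↦ Set.disjoint_left.2 ?_⟩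
  · by_cases hcl : j ∈ M.closure I
    · have hset : {i | ∃ h : j ∈ C \ I ∧ j ∈ M.closure I, f ⟨j, h⟩ = i} = {f ⟨j, hj, hcl⟩} := by
        ext i
        simp [hj.1, hj.2, hcl, eq_comm]
      obtain ⟨hcirc, hmem⟩ := hf ⟨j, hj, hcl⟩
      beta_reduce
      rw [hset]
      refine ⟨Set.singleton_subset_iff.2 hmem, (Set.encard_singleton _).le, ?_⟩
      have hne : j ≠ f ⟨j, hj, hcl⟩ := fun h ↦ hj.2 (h.symm ▸ hmem.1)
      rw [Set.insert_sdiff_singleton_comm hne]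
      exact (hI.mem_fundCircuit_iff hcl hj.2).1 hcirc
    · have hset : {i | ∃ h : j ∈ C \ I ∧ j ∈ M.closure I, f ⟨j, h⟩ = i} = ∅ := by
        ext i
        simp [hcl]
      beta_reduce
      rw [hset]
      refine ⟨Set.empty_subset _, by simp, ?_⟩
      rw [Set.sdiff_empty]
      exact (hI.notMem_closure_iff_of_notMem hj.2 (hC.subset_ground hj.1)).1 hcl
  · rintro _ ⟨h, rfl⟩ ⟨h', heq⟩
    exact hne (congrArg Subtype.val (hf_inj heq)).symm
end

section
/- Let M be a matroid on a finite ground set X with independent-set family ℐ and matroid polytope P(M) = conv{1_I : I ∈ ℐ}, and let f : 2^X → ℝ≥0 be a nonnegative submodular function with multilinear extension F. Let 𝒢 be a group of permutations of X that is element-transitive (the orbit {σ(i) : σ ∈ 𝒢} of every element i ∈ X is all of X), such that both f and ℐ are invariant under 𝒢 (f(σ(S)) = f(S) and S ∈ ℐ ⟺ σ(S) ∈ ℐ for all S and σ ∈ 𝒢). Then the symmetric optimum satisfies max{ F(x̄) : x ∈ P(M) } ≥ (1/2) · max{ f(S) : S ∈ ℐ }, where x̄ = (1/|𝒢|) ∑_{σ∈𝒢}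 σ(x). -/
open scoped Classical

open Finset in
/-- The mean of `g R` over a random subset `R` of `A` that contains each element of `A`
independently with probability `t`. -/
noncomputable def bernoulliMean {X : Type*} [DecidableEq X] (t : ℝ) (A : Finset X)
    (g : Finset X → ℝ) : ℝ :=
  ∑ R ∈ A.powerset, t ^ #R * (1 - t) ^ #(A \ R) * g R

section BernoulliMean

variable {X : Type*} [DecidableEq X]

theorem bernoulliMean_empty (t : ℝ) (g : Finset X → ℝ) : bernoulliMean t ∅ g = g ∅ := by
  simp [bernoulliMean]

theorem bernoulliMean_sub (t : ℝ) (A : Finset X) (g h : Finset X → ℝ) :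
    bernoulliMean t A (fun R => g R - h R) = bernoulliMean t A g - bernoulliMean t A h := by
  simp only [bernoulliMean, mul_sub, Finset.sum_sub_distrib]

theorem bernoulliMean_sum {ι : Type*} (t : ℝ) (A : Finset X) (s : Finset ι)
    (g : ι → Finset X → ℝ) :
    bernoulliMean t A (fun R => ∑ i ∈ s, g i R) = ∑ i ∈ s, bernoulliMean t A (g i) := by
  simp only [bernoulliMean, Finset.mul_sum]
  exact Finset.sum_comm

theorem bernoulliMean_congr {t : ℝ} {A : Finset X} {g h : Finset X → ℝ}
    (H : ∀ R ⊆ A, g R = h R) : bernoulliMean t A g = bernoulliMean t A h :=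
  Finset.sum_congr rfl fun R hR => by rw [H R (Finset.mem_powerset.1 hR)]

theorem bernoulliMean_mono {t : ℝ} (h0 : 0 ≤ t) (h1 : t ≤ 1) {A : Finset X}
    {g h : Finset X → ℝ} (H : ∀ R, g R ≤ h R) : bernoulliMean t A g ≤ bernoulliMean t A h :=
  Finset.sum_le_sum fun R _ => mul_le_mul_of_nonneg_left (H R)
    (mul_nonneg (pow_nonneg h0 _) (pow_nonneg (sub_nonneg.2 h1) _))

theorem bernoulliMean_insert (t : ℝ) {A : Finset X} {a : X} (ha : a ∉ A)
    (g : Finset X → ℝ) :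
    bernoulliMean t (insert a A) g =
      (1 - t) * bernoulliMean t A g + t * bernoulliMean t A (fun R => g (insert a R)) := by
  unfold bernoulliMean
  rw [Finset.sum_powerset_insert ha, Finset.mul_sum, Finset.mul_sum]
  congr 1 <;> refine Finset.sum_congr rfl fun R hR => ?_
  · have haR : a ∉ R := fun h => ha (Finset.mem_powerset.1 hR h)
    rw [Finset.insert_sdiff_of_notMem _ haR, Finset.card_insert_of_notMem (by simp [ha])]
    ring
  · have haR : a ∉ R := fun h => ha (Finset.mem_powerset.1 hR h)
    rw [Finset.card_insert_of_notMem haR, Finset.insert_sdiff_insert,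
      Finset.sdiff_insert_of_notMem ha]
    ring

theorem bernoulliMean_insert_of_forall_eq (t : ℝ) {A : Finset X} {a : X} (ha : a ∉ A)
    {g : Finset X → ℝ} (hg : ∀ R, a ∉ R → g (insert a R) = g R) :
    bernoulliMean t (insert a A) g = bernoulliMean t A g := by
  rw [bernoulliMean_insert t ha,
    bernoulliMean_congr (g := fun R => g (insert a R)) fun R hR => hg R fun h => ha (hR h)]
  ring

theorem bernoulliMean_insert_sub_erase (t : ℝ) {A : Finset X} {a : X} (ha : a ∉ A)
    (g : Finset X → ℝ) :
    (bernoulliMean t (insert a A) fun R => g (insert a R) - g (R.erase a)) =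
      bernoulliMean t A fun R => g (insert a R) - g R := by
  rw [bernoulliMean_insert_of_forall_eq t ha]
  · exact bernoulliMean_congr fun R hR => by
      rw [Finset.erase_eq_of_notMem fun h => ha (hR h)]
  · intro R hR
    rw [Finset.erase_insert hR, Finset.insert_idem, Finset.erase_eq_of_notMem hR]

theorem hasDerivAt_bernoulliMean (A : Finset X) (g : Finset X → ℝ) (t : ℝ) :
    HasDerivAt (fun s => bernoulliMean s A g)
      (∑ i ∈ A, bernoulliMean t A fun R => g (insert i R) - g (R.erase i)) t := by
  induction A using Finset.induction_on generalizing g with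
  | empty => simpa [bernoulliMean_empty] using hasDerivAt_const t (g ∅)
  | insert a A ha ih =>
    simp only [bernoulliMean_insert _ ha g]
    have h := (((hasDerivAt_id t).const_sub 1).mul (ih g)).add
      ((hasDerivAt_id t).mul (ih fun R => g (insert a R)))
    refine h.congr_deriv ?_
    rw [Finset.sum_insert ha, bernoulliMean_insert_sub_erase t ha, bernoulliMean_sub]
    have hsum : ∀ i ∈ A, (bernoulliMean t (insert a A) fun R => g (insert i R) - g (R.erase i)) =
        (1 - t) * (bernoulliMean t A fun R => g (insert i R) - g (R.erase i)) +
        t * bernoulliMean t A fun R => g (insert a (insert i R)) - g (insert a (R.erase i)) := by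
      intro i hi
      have hai : a ≠ i := fun h => ha (h ▸ hi)
      rw [bernoulliMean_insert t ha]
      simp only [Finset.insert_comm i a, Finset.erase_insert_of_ne hai]
    rw [Finset.sum_congr rfl hsum, Finset.sum_add_distrib, ← Finset.mul_sum, ← Finset.mul_sum]
    simp only [id]
    ring

theorem bernoulliMean_insert_sub (t : ℝ) {A : Finset X} {i : X} (hi : i ∈ A)
    (g : Finset X → ℝ) :
    (bernoulliMean t A fun R => g (insert i R) - g R) =
      (1 - t) * bernoulliMean t A fun R => g (insert i R) - g (R.erase i) := by
  obtain ⟨A, ha, rfl⟩ : ∃ B, i ∉ B ∧ A = insert i B :=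
    ⟨A.erase i, Finset.notMem_erase i A, (Finset.insert_erase hi).symm⟩
  rw [bernoulliMean_insert_sub_erase t ha, bernoulliMean_insert t ha]
  simp [bernoulliMean]

theorem bernoulliMean_sub_erase (t : ℝ) {A : Finset X} {i : X} (hi : i ∈ A)
    (g : Finset X → ℝ) :
    (bernoulliMean t A fun R => g R - g (R.erase i)) =
      t * bernoulliMean t A fun R => g (insert i R) - g (R.erase i) := by
  have h := bernoulliMean_insert_sub t hi g
  simp only [bernoulliMean_sub] at h ⊢
  linarith

theorem le_bernoulliMean_of_submodular {t : ℝ} (h0 : 0 ≤ t) (h1 : t ≤ 1)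
    {g : Finset X → ℝ} (hg : ∀ A B, g (A ∪ B) + g (A ∩ B) ≤ g A + g B) (A : Finset X) :
    (1 - t) * g ∅ + t * g A ≤ bernoulliMean t A g := by
  induction A using Finset.induction_on generalizing g with
  | empty => rw [bernoulliMean_empty]; linarith
  | insert a A ha ih =>
    rw [bernoulliMean_insert t ha]
    have e1 := ih hg
    have e2 := ih (g := fun R => g (insert a R)) fun A B => by
      simpa only [Finset.insert_union_distrib, Finset.insert_inter_distrib] using
        hg (insert a A) (insert a B)
    have e3 := hg A {a}
    rw [Finset.union_comm, ← Finset.insert_eq,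
      Finset.disjoint_iff_inter_eq_empty.1 (Finset.disjoint_singleton_right.2 ha)] at e3
    have h1' : 0 ≤ 1 - t := sub_nonneg.2 h1
    have e4 := mul_le_mul_of_nonneg_left e1 h1'
    have e5 := mul_le_mul_of_nonneg_left e2 h0
    have e6 := mul_le_mul_of_nonneg_left e3 (mul_nonneg h0 h1')
    simp only [insert_empty_eq] at e5
    nlinarith

theorem sub_le_sum_insert_sub_of_submodular {g : Finset X → ℝ}
    (hg : ∀ A B, g (A ∪ B) + g (A ∩ B) ≤ g A + g B) (R S : Finset X) :
    g (R ∪ S) - g R ≤ ∑ i ∈ S, (g (insert i R) - g R) := by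
  induction S using Finset.induction_on with
  | empty => simp
  | insert a S ha ih =>
    rw [Finset.sum_insert ha]
    have h := hg (R ∪ S) (insert a R)
    rw [show (R ∪ S) ∪ insert a R = R ∪ insert a S by grind,
      show (R ∪ S) ∩ insert a R = R by grind] at h
    linarith

theorem sum_sub_erase_le_of_submodular {g : Finset X → ℝ}
    (hg : ∀ A B, g (A ∪ B) + g (A ∩ B) ≤ g A + g B) (R S : Finset X) :
    ∑ i ∈ S, (g R - g (R.erase i)) ≤ g R - g (R \ S) := by
  induction S using Finset.induction_on with
  | empty => simp
  | insert a S ha ih =>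
    rw [Finset.sum_insert ha]
    have h := hg (R \ S) (R.erase a)
    rw [show (R \ S) ∪ R.erase a = R by grind,
      show (R \ S) ∩ R.erase a = R \ insert a S by grind] at h
    linarith

variable [Fintype X]

theorem mExt_const (f : Set X → ℝ) (t : ℝ) :
    mExt f (fun _ => t) = bernoulliMean t Finset.univ fun R : Finset X => f R := by
  simp only [mExt, bernoulliMean, Finset.prod_const, Finset.powerset_univ,
    Finset.compl_eq_univ_sdiff]
  exact Finset.sum_congr rfl fun _ _ => mul_comm _ _

theorem bernoulliMean_univ_map (t : ℝ) (σ : Equiv.Perm X) (g : Finset X → ℝ) :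
    (bernoulliMean t Finset.univ fun R => g (R.map σ.toEmbedding)) =
      bernoulliMean t Finset.univ g := by
  simp only [bernoulliMean, Finset.powerset_univ, ← Finset.compl_eq_univ_sdiff,
    Finset.card_compl]
  refine Fintype.sum_equiv σ.finsetCongr _ _ fun R => ?_
  simp

theorem bernoulliMean_univ_insert_sub_erase_eq (t : ℝ) {σ : Equiv.Perm X} {g : Finset X → ℝ}
    (hg : ∀ R : Finset X, g (R.map σ.toEmbedding) = g R) (i : X) :
    (bernoulliMean t Finset.univ fun R => g (insert (σ i) R) - g (R.erase (σ i))) =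
      bernoulliMean t Finset.univ fun R => g (insert i R) - g (R.erase i) := by
  rw [← bernoulliMean_univ_map t σ]
  refine bernoulliMean_congr fun R _ => ?_
  rw [← hg (insert i R), ← hg (R.erase i), Finset.map_insert, Finset.map_erase]
  rfl

open Finset in
/-- If the discrete derivatives of `g` at a random set of density `t` all have mean `d`, then
comparing with `S` loses at most `d * (|S| - t * |X|)`. -/
theorem le_two_mul_bernoulliMean_add {t : ℝ} (h0 : 0 ≤ t) (h1 : t ≤ 1)
    {g : Finset X → ℝ} (hpos : ∀ A, 0 ≤ g A)
    (hg : ∀ A B, g (A ∪ B) + g (A ∩ B) ≤ g A + g B) {d : ℝ}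
    (hd : ∀ i, (bernoulliMean t univ fun R => g (insert i R) - g (R.erase i)) = d)
    (S : Finset X) :
    g S ≤ 2 * bernoulliMean t univ g + d * (#S - t * Fintype.card X) := by
  have hup : bernoulliMean t univ (fun R => g (R ∪ S) - g R) ≤ #S * ((1 - t) * d) := by
    refine (bernoulliMean_mono h0 h1 fun R =>
      sub_le_sum_insert_sub_of_submodular hg R S).trans_eq ?_
    rw [bernoulliMean_sum, sum_congr rfl fun i _ =>
      (bernoulliMean_insert_sub t (mem_univ i) g).trans (by rw [hd i]),
      sum_const, nsmul_eq_mul]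
  have hdown : #Sᶜ * (t * d) ≤ bernoulliMean t univ fun R => g R - g (R ∩ S) := by
    refine le_trans (Eq.le ?_) (bernoulliMean_mono h0 h1 fun R =>
      (sum_sub_erase_le_of_submodular hg R Sᶜ).trans_eq (by
        rw [sdiff_compl, inf_eq_inter]))
    rw [bernoulliMean_sum, sum_congr rfl fun i _ =>
      (bernoulliMean_sub_erase t (mem_univ i) g).trans (by rw [hd i]),
      sum_const, nsmul_eq_mul]
  have hunion := le_bernoulliMean_of_submodular h0 h1 (g := fun R => g (R ∪ S))
    (fun A B => by
      rw [union_union_distrib_right, inter_union_distrib_right]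
      exact hg (A ∪ S) (B ∪ S)) univ
  have hinter := le_bernoulliMean_of_submodular h0 h1 (g := fun R => g (R ∩ S))
    (fun A B => by
      rw [union_inter_distrib_right, inter_inter_distrib_right]
      exact hg (A ∩ S) (B ∩ S)) univ
  simp only [empty_union, empty_inter, univ_inter] at hunion hinter
  rw [bernoulliMean_sub] at hup hdown
  have hcard : (#Sᶜ : ℝ) = Fintype.card X - #S := by
    rw [card_compl, Nat.cast_sub (card_le_univ S)]
  rw [hcard] at hdown
  have p1 := mul_nonneg h0 (hpos (univ ∪ S))
  have p2 := mul_nonneg (sub_nonneg.2 h1) (hpos ∅)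
  linarith

end BernoulliMean

theorem symmetrize_eq_const {X : Type*} [Fintype X] {G : Subgroup (Equiv.Perm X)}
    (htrans : ∀ i j : X, ∃ σ ∈ G, (σ : Equiv.Perm X) i = j) (x : X → ℝ) :
    symmetrize G x = fun _ => (∑ i, x i) / Fintype.card X := by
  have hconst : ∀ i j, ∑ σ : G, x ((σ : Equiv.Perm X)⁻¹ i) =
      ∑ σ : G, x ((σ : Equiv.Perm X)⁻¹ j) := by
    intro i j
    obtain ⟨τ, hτ, rfl⟩ := htrans i j
    exact Fintype.sum_equiv (Equiv.mulLeft (⟨τ, hτ⟩ : G)) _ _ fun σ => by simp [mul_inv_rev]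
  funext i
  have hX : (Fintype.card X : ℝ) ≠ 0 :=
    Nat.cast_ne_zero.2 (Fintype.card_pos_iff.2 ⟨i⟩).ne'
  have hG : (Fintype.card G : ℝ) ≠ 0 := Nat.cast_ne_zero.2 Fintype.card_ne_zero
  have hsum : ∑ j, ∑ σ : G, x ((σ : Equiv.Perm X)⁻¹ j) = Fintype.card G * ∑ j, x j := by
    have hperm : ∀ σ : G, ∑ j, x ((σ : Equiv.Perm X)⁻¹ j) = ∑ j, x j := fun σ =>
      Equiv.sum_comp (σ : Equiv.Perm X)⁻¹ x
    rw [Finset.sum_comm, Finset.sum_congr rfl fun σ _ => hperm σ, Finset.sum_const,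
      Finset.card_univ, nsmul_eq_mul]
  rw [Finset.sum_congr rfl fun j _ => hconst j i] at hsum
  simp only [Finset.sum_const, Finset.card_univ, nsmul_eq_mul] at hsum
  rw [symmetrize, div_eq_div_iff hG hX]
  linarith

/-- if `f` is nonnegative submodular and both `f` and the independent
sets of `M` are invariant under an element-transitive group `𝒢` of permutations of
`X`, then the symmetric optimum over the matroid polytope `P(M)` is at least half the
discrete optimum: `max{F(x̄) : x ∈ P(M)} ≥ (1/2)·max{f(S) : S independent}`. -/
theorem stmt_17 {X : Type*} [Fintype X] [DecidableEq X] (M : Matroid X)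
    (hE : M.E = Set.univ)
    (f : Set X → ℝ) (hf0 : ∀ S : Set X, 0 ≤ f S)
    (hsub : ∀ S T : Set X, f (S ∪ T) + f (S ∩ T) ≤ f S + f T)
    (G : Subgroup (Equiv.Perm X))
    (htrans : ∀ i j : X, ∃ σ ∈ G, (σ : Equiv.Perm X) i = j)
    (hfinv : ∀ σ ∈ G, ∀ S : Set X, f ((σ : Equiv.Perm X) '' S) = f S)
    (hIinv : ∀ σ ∈ G, ∀ S : Set X, M.Indep ((σ : Equiv.Perm X) '' S) ↔ M.Indep S) :
    ∃ x ∈ (convexHull ℝ) {v : X → ℝ | ∃ I : Set X, M.Indep I ∧ v = Set.indicator I 1},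
      ∀ S : Set X, M.Indep S → (1 / 2) * f S ≤ mExt f (symmetrize G x) := by
  obtain ⟨B, hB⟩ := M.exists_isBase
  set n : ℝ := (Fintype.card X : ℝ) with hn
  set r : ℝ := (B.ncard : ℝ) with hr
  have hr0 : 0 ≤ r := Nat.cast_nonneg _
  have hn0 : 0 ≤ n := Nat.cast_nonneg _
  have hrn : r ≤ n := by
    rw [hr, hn, ← Nat.card_eq_fintype_card]
    exact_mod_cast Set.ncard_le_card B
  set g : Finset X → ℝ := fun R => f R with hg
  have hgsub : ∀ A B, g (A ∪ B) + g (A ∩ B) ≤ g A + g B := fun A B => by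
    simpa [hg] using hsub A B
  obtain ⟨t, ⟨ht0, htr⟩, hmax⟩ := (isCompact_Icc (a := (0 : ℝ)) (b := r / n)).exists_isMaxOn
    (Set.nonempty_Icc.2 (by positivity)) (f := fun s => bernoulliMean s Finset.univ g)
    fun s _ => (hasDerivAt_bernoulliMean _ g s).continuousAt.continuousWithinAt
  have ht1 : t ≤ 1 := htr.trans (div_le_one_of_le₀ hrn hn0)
  have hsx : ∑ i, (t * n / r) • (B.indicator 1 : X → ℝ) i = t * n := by
    have hB1 : ∑ i, (B.indicator 1 : X → ℝ) i = r := by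
      simp [Set.indicator_apply, hr, Set.ncard_eq_toFinset_card', Set.toFinset]
    rw [← Finset.smul_sum, hB1, smul_eq_mul]
    refine div_mul_cancel_of_imp fun h => ?_
    have : t = 0 := le_antisymm (by simpa [h] using htr) ht0
    simp [this]
  refine ⟨(t * n / r) • B.indicator 1, ?_, fun S hS => ?_⟩
  · have h0 : (0 : X → ℝ) ∈ convexHull ℝ
        {v : X → ℝ | ∃ I : Set X, M.Indep I ∧ v = Set.indicator I 1} :=
      subset_convexHull ℝ _ ⟨∅, M.empty_indep, (Set.indicator_empty (M := ℝ) _).symm⟩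
    have hB' : (B.indicator 1 : X → ℝ) ∈ convexHull ℝ
        {v : X → ℝ | ∃ I : Set X, M.Indep I ∧ v = Set.indicator I 1} :=
      subset_convexHull ℝ _ ⟨B, hB.indep, rfl⟩
    refine (convex_convexHull ℝ _).smul_mem_of_zero_mem h0 hB' ⟨by positivity, ?_⟩
    refine div_le_one_of_le₀ ?_ hr0
    rcases hn0.eq_or_lt with h | h
    · simpa [← h] using hr0
    · exact (le_div_iff₀ h).1 htr
  · rcases isEmpty_or_nonempty X with hX | ⟨⟨a⟩⟩
    · rw [show symmetrize G ((t * n / r) • B.indicator 1) = fun _ => t from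
        Subsingleton.elim _ _, mExt_const]
      have : S = ∅ := Set.eq_empty_of_isEmpty S
      rw [this, Finset.univ_eq_empty, bernoulliMean_empty, Finset.coe_empty]
      linarith [hf0 ∅]
    have hnpos : 0 < n := Nat.cast_pos.2 (Fintype.card_pos_iff.2 ⟨a⟩)
    rw [symmetrize_eq_const htrans]
    simp only [Pi.smul_apply]
    rw [hsx, mul_div_cancel_right₀ _ hnpos.ne', mExt_const]
    set d := bernoulliMean t Finset.univ fun R => g (insert a R) - g (R.erase a)
    have hd : ∀ i,
        (bernoulliMean t Finset.univ fun R => g (insert i R) - g (R.erase i)) = d := by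
      intro i
      obtain ⟨σ, hσ, rfl⟩ := htrans a i
      exact bernoulliMean_univ_insert_sub_erase_eq t
        (fun R => by simpa [hg] using hfinv σ hσ R) a
    have hderiv := hasDerivAt_bernoulliMean Finset.univ g t
    simp only [hd, Finset.sum_const, Finset.card_univ, nsmul_eq_mul] at hderiv
    have hcard : (S.toFinset.card : ℝ) ≤ r := by
      obtain ⟨B', hB', hSB⟩ := hS.exists_isBase_superset
      rw [← Set.ncard_eq_toFinset_card', hr, hB.ncard_eq_ncard_of_isBase hB']
      exact_mod_cast Set.ncard_le_ncard hSB
    have hvar : (S.toFinset.card / n - t) * (n * d) ≤ 0 := by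
      have hs : (S.toFinset.card : ℝ) / n ∈ Set.Icc 0 (r / n) :=
        ⟨by positivity, div_le_div_of_nonneg_right hcard hn0⟩
      have := (hmax.localize).hasFDerivWithinAt_nonpos hderiv.hasFDerivAt.hasFDerivWithinAt
        (sub_mem_posTangentConeAt_of_segment_subset
          ((convex_Icc (0 : ℝ) (r / n)).segment_subset ⟨ht0, htr⟩ hs))
      simpa using this
    have key := le_two_mul_bernoulliMean_add ht0 ht1 (fun A => hf0 A) hgsub hd S.toFinset
    have e : (S.toFinset.card / n - t) * (n * d) = d * (S.toFinset.card - t * n) := by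
      field_simp
    rw [e] at hvar
    simp only [Set.coe_toFinset] at key hvar ⊢
    linarith
end
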